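/- arXiv:1203.4581 — 2 statements merged into one kernel-verified Lean document; each statement's English description precedes it below -/
import Mathlib

section
/- Let K be a finite simplicial complex and X, Y non-empty compact (Hausdorff) spaces. Then: (1) K-Ind Z(X,Y) ≤ max{ K-Ind X + 1, K-Ind Y }; (2) if moreover K-str X = 0, then K-Ind Z(X,Y) = max{ K-Ind X, K-Ind Y }; (3) if K = ∂Δ^k with k ≥ 2 and ∂Δ^k-Ind Y < ∂Δ^k-Ind X + 1 = ∂Δ^k-Ind Z(X,Y), then ∂Δ^k-str Z(X,Y) = 0. -/
open Set Topology Cardinal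

noncomputable section

attribute [local instance] Classical.propDecidable

/-- Values of dimension functions: `⊥ : WithBot Ordinal.{0}` encodes `−1`,
ordinals are the usual values, and `⊤` encodes `∞`. -/
abbrev Dim : Type 1 := WithTop (WithBot Ordinal.{0})

/-- An ordinal viewed as a dimension value. -/
def Dim.ofOrdinal (a : Ordinal.{0}) : Dim := ((a : WithBot Ordinal.{0}) : Dim)

/-- The dimension value `−1`. -/
def Dim.minusOne : Dim := ((⊥ : WithBot Ordinal.{0}) : Dim)

/-- An integer `m ≥ −1` viewed as a dimension value. -/
def Dim.ofInt (m : ℤ) : Dim := if 0 ≤ m then Dim.ofOrdinal m.toNat else Dim.minusOne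

/-- `A` is a `K`-tuple for the simplicial complex `K` on the vertex set `Fin m`:
whenever the members indexed by a nonempty `I` have a common point, `I` spans a
simplex of `K`. -/
def IsKTuple {m : ℕ} (K : Finset (Fin m) → Prop) {X : Type} (A : Fin m → Set X) : Prop :=
  ∀ I : Finset (Fin m), I.Nonempty → (⋂ i ∈ I, A i).Nonempty → K I

/-- `K` is an abstract (finite) simplicial complex with vertex set `Fin m`:
it is closed under passing to nonempty subsets, and contains every vertex. -/
def IsComplex {m : ℕ} (K : Finset (Fin m) → Prop) : Prop :=
  (∀ s t : Finset (Fin m), s ⊆ t → s.Nonempty → K t → K s) ∧ ∀ i, K {i}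

/-- The boundary complex `∂Δ^k` of the `k`-simplex: all proper subsets of the
`k+1` vertices span simplices. -/
def bComplex (k : ℕ) : Finset (Fin (k + 1)) → Prop := fun s => s ≠ Finset.univ

/-- `U` is an (open) `K`-neighbourhood of the tuple `F`. -/
def KNbhd {m : ℕ} (K : Finset (Fin m) → Prop) {X : Type} [TopologicalSpace X]
    (F U : Fin m → Set X) : Prop :=
  (∀ i, IsOpen (U i)) ∧ IsKTuple K U ∧ ∀ i, F i ⊆ U i

/-- Auxiliary form of `K-Ind X ≤ α`, defined by transfinite recursion on `α`:
every closed `K`-tuple has a `K`-neighbourhood whose corresponding `K`-partition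
is either empty (dimension `−1`) or has `K-Ind < α`. -/
def KIndLeAux {m : ℕ} (K : Finset (Fin m) → Prop) :
    Ordinal.{0} → ∀ X : Type, TopologicalSpace X → Prop :=
  (wellFounded_lt (α := Ordinal.{0})).fix fun α rec X tX =>
    letI := tX
    ∀ F : Fin m → Set X, (∀ i, IsClosed (F i)) → IsKTuple K F →
      ∃ U : Fin m → Set X, (∀ i, IsOpen (U i)) ∧ IsKTuple K U ∧ (∀ i, F i ⊆ U i) ∧
        ((⋃ i, U i)ᶜ = (∅ : Set X) ∨
          ∃ β : Set.Iio α, rec β.1 β.2 (↥((⋃ i, U i)ᶜ)) inferInstance)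

/-- `K-Ind X ≤ α` (for an ordinal `α ≥ 0`). -/
def KIndLE {m : ℕ} (K : Finset (Fin m) → Prop) (X : Type) [tX : TopologicalSpace X]
    (α : Ordinal.{0}) : Prop :=
  KIndLeAux K α X tX

/-- Fedorchuk's inductive dimension `K-Ind` modulo a simplicial complex `K`;
`−1` for the empty space, the least `α` with `K-Ind X ≤ α` otherwise, `∞` if none. -/
def KInd {m : ℕ} (K : Finset (Fin m) → Prop) (X : Type) [TopologicalSpace X] : Dim :=
  if IsEmpty X then Dim.minusOne
  else if ∃ α, KIndLE K X α then Dim.ofOrdinal (sInf {α | KIndLE K X α}) else ⊤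

/-- The set of `K`-obstruction points of an open `K`-tuple `U`: points covered
by no `K`-neighbourhood of `U`. -/
def KObs {m : ℕ} (K : Finset (Fin m) → Prop) {X : Type} [TopologicalSpace X]
    (U : Fin m → Set X) : Set X :=
  {x | ¬ ∃ V : Fin m → Set X, KNbhd K U V ∧ x ∈ ⋃ i, V i}

/-- `X` is strongly `α`-dimensional: `K-Ind X` is a positive ordinal `α` and some
closed `K`-tuple admits no `K`-neighbourhood `U` without obstruction points whose
corresponding `K`-partition has `K-Ind < α`. -/
def KStrongly {m : ℕ} (K : Finset (Fin m) → Prop) (X : Type) [TopologicalSpace X] : Prop :=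
  (∃ α : Ordinal.{0}, 0 < α ∧ KInd K X = Dim.ofOrdinal α) ∧
  ∃ F : Fin m → Set X, (∀ i, IsClosed (F i)) ∧ IsKTuple K F ∧
    ∀ U : Fin m → Set X, KNbhd K F U →
      KInd K (↥((⋃ i, U i)ᶜ)) < KInd K X → KObs K U ≠ ∅

/-- The dimensional strength degree `K-str X ∈ {0,1}`. -/
def KStr {m : ℕ} (K : Finset (Fin m) → Prop) (X : Type) [TopologicalSpace X] : ℕ :=
  if KStrongly K X then 1 else 0

/-- `K-dim X ≤ n`: any `n+1` closed `K`-tuples admit `K`-partitions with empty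
intersection. -/
def KDimLE {m : ℕ} (K : Finset (Fin m) → Prop) (X : Type) [TopologicalSpace X] (n : ℕ) : Prop :=
  ∀ F : Fin (n + 1) → Fin m → Set X,
    (∀ j i, IsClosed (F j i)) → (∀ j, IsKTuple K (F j)) →
    ∃ U : Fin (n + 1) → Fin m → Set X, (∀ j, KNbhd K (F j) (U j)) ∧
      (⋂ j, (⋃ i, U j i)ᶜ) = (∅ : Set X)

/-- Fedorchuk's dimension `K-dim` modulo a simplicial complex `K`. -/
def KDim {m : ℕ} (K : Finset (Fin m) → Prop) (X : Type) [TopologicalSpace X] : Dim :=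
  if IsEmpty X then Dim.minusOne
  else if ∃ n, KDimLE K X n then Dim.ofOrdinal ((sInf {n | KDimLE K X n} : ℕ) : Ordinal.{0}) else ⊤

/-- `dim X ≤ n` for the Lebesgue covering dimension: every finite open cover has
an open shrinking of order at most `n+1`. -/
def CovDimLE (X : Type) [TopologicalSpace X] (n : ℕ) : Prop :=
  ∀ (ι : Type), Finite ι → ∀ U : ι → Set X, (∀ i, IsOpen (U i)) → (⋃ i, U i) = Set.univ →
    ∃ V : ι → Set X, (∀ i, IsOpen (V i)) ∧ (∀ i, V i ⊆ U i) ∧ (⋃ i, V i) = Set.univ ∧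
      ∀ x : X, ({i | x ∈ V i}).ncard ≤ n + 1

/-- The Lebesgue covering dimension. -/
def covDim (X : Type) [TopologicalSpace X] : Dim :=
  if IsEmpty X then Dim.minusOne
  else if ∃ n, CovDimLE X n then Dim.ofOrdinal ((sInf {n | CovDimLE X n} : ℕ) : Ordinal.{0}) else ⊤

/-- `Ind X ≤ n` for the large inductive dimension, by recursion on `n`. -/
def IndLE : ℕ → ∀ X : Type, TopologicalSpace X → Prop
  | 0, X, tX =>
    letI := tX
    ∀ F U : Set X, IsClosed F → IsOpen U → F ⊆ U →
      ∃ V : Set X, IsOpen V ∧ F ⊆ V ∧ V ⊆ U ∧ frontier V = ∅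
  | n + 1, X, tX =>
    letI := tX
    ∀ F U : Set X, IsClosed F → IsOpen U → F ⊆ U →
      ∃ V : Set X, IsOpen V ∧ F ⊆ V ∧ V ⊆ U ∧ IndLE n (↥(frontier V)) inferInstance

/-- The large inductive dimension `Ind`. -/
def IndDim (X : Type) [tX : TopologicalSpace X] : Dim :=
  if IsEmpty X then Dim.minusOne
  else if ∃ n, IndLE n X tX then Dim.ofOrdinal ((sInf {n | IndLE n X tX} : ℕ) : Ordinal.{0}) else ⊤

/-- The relation generating the topological join `A ∗ B`: the copy of `B` is
collapsed at parameter `0`, the copy of `A` at parameter `1`. -/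
def JoinRel (A B : Type) : (A × B × unitInterval) → (A × B × unitInterval) → Prop :=
  fun p q => (p.2.2 = 0 ∧ q.2.2 = 0 ∧ p.1 = q.1) ∨ (p.2.2 = 1 ∧ q.2.2 = 1 ∧ p.2.1 = q.2.1)

/-- The topological join `A ∗ B`. -/
abbrev Join (A B : Type) [TopologicalSpace A] [TopologicalSpace B] : Type :=
  Quot (JoinRel A B)

/-- Auxiliary construction of the join of `n+1` copies of `L`, bundled with its
topology. -/
def JoinPowAux (L : Type) (tL : TopologicalSpace L) : ℕ → (T : Type) × TopologicalSpace T
  | 0 => ⟨L, tL⟩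
  | n + 1 =>
    let p := JoinPowAux L tL n
    letI := tL
    letI := p.2
    ⟨Join L p.1, inferInstance⟩

/-- The join `L ∗ ⋯ ∗ L` of `n+1` copies of `L`. -/
def JoinPow (L : Type) [tL : TopologicalSpace L] (n : ℕ) : Type :=
  (JoinPowAux L tL n).1

instance joinPowTopologicalSpace (L : Type) [tL : TopologicalSpace L] (n : ℕ) :
    TopologicalSpace (JoinPow L n) :=
  (JoinPowAux L tL n).2

/-- `L-dim X ≤ n`: every continuous map from a closed subset of `X` to the join
of `n+1` copies of `L` extends continuously over `X`. -/
def LDimLE (L : Type) [TopologicalSpace L] (X : Type) [TopologicalSpace X] (n : ℕ) : Prop :=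
  ∀ F : Set X, IsClosed F → ∀ f : C(F, JoinPow L n),
    ∃ g : C(X, JoinPow L n), ∀ x : F, g x = f x

/-- Fedorchuk's dimension `L-dim` modulo an ANR `L`. -/
def LDim (L : Type) [TopologicalSpace L] (X : Type) [TopologicalSpace X] : Dim :=
  if IsEmpty X then Dim.minusOne
  else if ∃ n, LDimLE L X n then Dim.ofOrdinal ((sInf {n | LDimLE L X n} : ℕ) : Ordinal.{0}) else ⊤

/-- Auxiliary form of `L-Ind X ≤ α`, by transfinite recursion on `α`: every map
to `L` from a closed subset of `X` has an `L`-partition which is either empty or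
has `L-Ind < α`. -/
def LIndLeAux (L : Type) [TopologicalSpace L] :
    Ordinal.{0} → ∀ X : Type, TopologicalSpace X → Prop :=
  (wellFounded_lt (α := Ordinal.{0})).fix fun α rec X tX =>
    letI := tX
    ∀ F : Set X, IsClosed F → ∀ f : C(F, L),
      ∃ U : Set X, IsOpen U ∧ ∃ hFU : F ⊆ U,
        (∃ g : C(U, L), ∀ (x : X) (hx : x ∈ F), g ⟨x, hFU hx⟩ = f ⟨x, hx⟩) ∧
        (Uᶜ = (∅ : Set X) ∨ ∃ β : Set.Iio α, rec β.1 β.2 (↥(Uᶜ)) inferInstance)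

/-- `L-Ind X ≤ α` (for an ordinal `α ≥ 0`). -/
def LIndLE (L : Type) [TopologicalSpace L] (X : Type) [tX : TopologicalSpace X]
    (α : Ordinal.{0}) : Prop :=
  LIndLeAux L α X tX

/-- Fedorchuk's inductive dimension `L-Ind` modulo an ANR `L`. -/
def LInd (L : Type) [TopologicalSpace L] (X : Type) [TopologicalSpace X] : Dim :=
  if IsEmpty X then Dim.minusOne
  else if ∃ α, LIndLE L X α then Dim.ofOrdinal (sInf {α | LIndLE L X α}) else ⊤

/-- `L` is an absolute neighbourhood retract (for metric spaces): `L` is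
metrizable and whenever a closed subset `A` of a metric space is homeomorphic to
`L` via `e`, the map `e` extends continuously over a neighbourhood of `A`. -/
def IsANR (L : Type) [TopologicalSpace L] : Prop :=
  TopologicalSpace.MetrizableSpace L ∧
  ∀ (M : Type) [MetricSpace M], ∀ A : Set M, IsClosed A → ∀ e : A ≃ₜ L,
    ∃ U : Set M, IsOpen U ∧ ∃ hAU : A ⊆ U, ∃ r : C(U, L),
      ∀ (a : M) (ha : a ∈ A), r ⟨a, hAU ha⟩ = e ⟨a, ha⟩

/-- `L-Ind_{b+} X`: the least dimension value `d` such that some open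
neighbourhood of `b` has closure of `L-Ind` at most `d`. -/
def LIndPlus (L : Type) [TopologicalSpace L] {X : Type} [TopologicalSpace X] (b : X) : Dim :=
  sInf {d : Dim | ∃ U : Set X, IsOpen U ∧ b ∈ U ∧ LInd L (↥(closure U)) ≤ d}

/-- The set `K(X) = {b ∈ X : L-Ind_{b+} X = L-Ind X}`. -/
def LKset (L : Type) [TopologicalSpace L] (X : Type) [TopologicalSpace X] : Set X :=
  {b | LIndPlus L b = LInd L X}

/-- The weight of a topological space: the least cardinality of a basis. -/
def tWeight (X : Type) [TopologicalSpace X] : Cardinal :=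
  sInf {c | ∃ B : Set (Set X), TopologicalSpace.IsTopologicalBasis B ∧ #B = c}

/-- The family `𝒮_X` of all subsets of `X` that are finite or homeomorphic to the
one-point compactification `A_{ℵ₀}` of a countably infinite discrete space. -/
def SFam (X : Type) [TopologicalSpace X] : Set (Set X) :=
  {S | S.Finite ∨ Nonempty (↥S ≃ₜ OnePoint ℕ)}

/-- The relation generating the quotient `N` in the `Z(X,Y)` construction:
each set `{μ} × {x} × Y` is collapsed to a point. -/
def ZRel (ι X Y : Type) : (OnePoint ι × X × Y) → (OnePoint ι × X × Y) → Prop :=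
  fun p q => p.1 = OnePoint.infty ∧ q.1 = OnePoint.infty ∧ p.2.1 = q.2.1

/-- The quotient space `N` of `A_𝔪 × X × Y`. -/
abbrev ZQuot (ι X Y : Type) [TopologicalSpace ι] [TopologicalSpace X] [TopologicalSpace Y] :
    Type :=
  Quot (ZRel ι X Y)

/-- The subset `Z(X,Y) = ⋃_{α ∈ A_𝔪} H(α)` of `N`:  `H(μ) = π₁({μ} × X × Y)` and
`H(α) = π₁({α} × φ(α) × Y)` for `α ≠ μ`. -/
def ZSet (ι X Y : Type) [TopologicalSpace ι] [TopologicalSpace X] [TopologicalSpace Y]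
    (φ : ι → Set X) : Set (ZQuot ι X Y) :=
  {z | ∃ p : OnePoint ι × X × Y, Quot.mk (ZRel ι X Y) p = z ∧
        (p.1 = OnePoint.infty ∨ ∃ i : ι, p.1 = (i : OnePoint ι) ∧ p.2.1 ∈ φ i)}

/-- The space `Z(X,Y)` (for the data `ι`, `φ`), with the subspace topology. -/
abbrev ZSpace (ι X Y : Type) [TopologicalSpace ι] [TopologicalSpace X] [TopologicalSpace Y]
    (φ : ι → Set X) : Type :=
  ↥(ZSet ι X Y φ)

/-- The subset `H(μ)` of `Z(X,Y)`. -/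
def ZHmu (ι X Y : Type) [TopologicalSpace ι] [TopologicalSpace X] [TopologicalSpace Y]
    (φ : ι → Set X) : Set (ZSpace ι X Y φ) :=
  {z | ∃ (x : X) (y : Y), (z : ZQuot ι X Y) = Quot.mk (ZRel ι X Y) (OnePoint.infty, x, y)}

/-- The projection `π_X : N → X`, `π₁(α,x,y) ↦ x`. -/
def ZQuotProjX {ι X Y : Type} [TopologicalSpace ι] [TopologicalSpace X] [TopologicalSpace Y] :
    ZQuot ι X Y → X :=
  Quot.lift (fun p => p.2.1) (fun _ _ h => h.2.2)

/-- The projection `π_X : Z(X,Y) → X`. -/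
def ZProjX {ι X Y : Type} [TopologicalSpace ι] [TopologicalSpace X] [TopologicalSpace Y]
    (φ : ι → Set X) : ZSpace ι X Y φ → X :=
  fun z => ZQuotProjX (z : ZQuot ι X Y)

/-- The cardinality requirements on the index set `ι` (of cardinality `𝔪`) in the
`Z(X,Y)` construction: `𝔪 ≥ max {ℵ₀, (wX)⁺, (wY)⁺, card 𝒮_X}`. -/
def ZCardOK (X Y ι : Type) [TopologicalSpace X] [TopologicalSpace Y] : Prop :=
  ℵ₀ ≤ #ι ∧ tWeight X < #ι ∧ tWeight Y < #ι ∧ #(SFam X) ≤ #ι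

/-- The requirements on `φ : A_𝔪 \ {μ} → 𝒮_X`: it takes values in `𝒮_X` and every
fibre has cardinality `𝔪`. -/
def ZPhiOK {X ι : Type} [TopologicalSpace X] (φ : ι → Set X) : Prop :=
  (∀ i, φ i ∈ SFam X) ∧ ∀ S ∈ SFam X, #(↥(φ ⁻¹' {S})) = #ι




/-! ### Basic facts on `K`-tuples and `KIndLE` -/

/-- `K-Ind X < α`. -/
def KIndLT {m : ℕ} (K : Finset (Fin m) → Prop) (X : Type) [TopologicalSpace X]
    (α : Ordinal.{0}) : Prop :=
  IsEmpty X ∨ ∃ β, β < α ∧ KIndLE K X β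

theorem isKTuple_iff {m : ℕ} {K : Finset (Fin m) → Prop} {X : Type} {A : Fin m → Set X} :
    IsKTuple K A ↔ ∀ x, ∀ I : Finset (Fin m), I.Nonempty → (∀ i ∈ I, x ∈ A i) → K I := by
  unfold IsKTuple
  constructor
  · intro h x I hI hx
    exact h I hI ⟨x, by simpa using hx⟩
  · rintro h I hI ⟨x, hx⟩
    exact h x I hI (by simpa using hx)

theorem IsKTuple.mono' {m : ℕ} {K : Finset (Fin m) → Prop} {X : Type} {A B : Fin m → Set X}
    (h : IsKTuple K B) (hAB : ∀ i, A i ⊆ B i) : IsKTuple K A := by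
  rw [isKTuple_iff] at *
  exact fun x I hI hx => h x I hI fun i hi => hAB i (hx i hi)

theorem IsKTuple.preimage {m : ℕ} {K : Finset (Fin m) → Prop} {X Y : Type} {A : Fin m → Set X}
    (h : IsKTuple K A) (f : Y → X) : IsKTuple K (fun i => f ⁻¹' A i) := by
  rw [isKTuple_iff] at *
  exact fun x I hI hx => h (f x) I hI hx

theorem IsKTuple.image {m : ℕ} {K : Finset (Fin m) → Prop} {X Y : Type} {A : Fin m → Set X}
    (h : IsKTuple K A) {f : X → Y} (hf : Function.Injective f) :
    IsKTuple K (fun i => f '' A i) := by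
  rw [isKTuple_iff] at *
  intro y I hI hy
  obtain ⟨i, hi⟩ := hI
  obtain ⟨x, hx, rfl⟩ := hy i hi
  exact h x I ⟨i, hi⟩ fun j hj => (hf.mem_set_image).1 (hy j hj)

theorem kIndLE_iff {m : ℕ} {K : Finset (Fin m) → Prop} {X : Type} [tX : TopologicalSpace X]
    {α : Ordinal.{0}} :
    KIndLE K X α ↔ ∀ F : Fin m → Set X, (∀ i, IsClosed (F i)) → IsKTuple K F →
      ∃ U : Fin m → Set X, KNbhd K F U ∧ KIndLT K (↥((⋃ i, U i)ᶜ)) α := by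
  have key : KIndLE K X α ↔ ∀ F : Fin m → Set X, (∀ i, IsClosed (F i)) → IsKTuple K F →
      ∃ U : Fin m → Set X, (∀ i, IsOpen (U i)) ∧ IsKTuple K U ∧ (∀ i, F i ⊆ U i) ∧
        ((⋃ i, U i)ᶜ = (∅ : Set X) ∨
          ∃ β : Set.Iio α, KIndLE K (↥((⋃ i, U i)ᶜ)) β.1) := by
    unfold KIndLE
    conv_lhs => unfold KIndLeAux
    rw [WellFounded.fix_eq]
    rfl
  rw [key]
  unfold KNbhd KIndLT
  refine forall_congr' fun F => forall_congr' fun _ => forall_congr' fun _ =>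
    exists_congr fun U => ?_
  have h2 : (∃ β : Set.Iio α, KIndLE K (↥((⋃ i, U i)ᶜ)) β.1) ↔
      ∃ β, β < α ∧ KIndLE K (↥((⋃ i, U i)ᶜ)) β := by
    constructor
    · rintro ⟨⟨b, hb⟩, h⟩; exact ⟨b, hb, h⟩
    · rintro ⟨b, hb, h⟩; exact ⟨⟨b, hb⟩, h⟩
  rw [h2, Set.isEmpty_coe_sort]
  tauto

theorem KIndLT.mono {m : ℕ} {K : Finset (Fin m) → Prop} {X : Type} [TopologicalSpace X]
    {α β : Ordinal.{0}} (h : KIndLT K X α) (hab : α ≤ β) : KIndLT K X β := by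
  rcases h with h | ⟨γ, hγ, h⟩
  · exact Or.inl h
  · exact Or.inr ⟨γ, hγ.trans_le hab, h⟩

theorem KIndLE.mono {m : ℕ} {K : Finset (Fin m) → Prop} {X : Type} [TopologicalSpace X]
    {α β : Ordinal.{0}} (h : KIndLE K X α) (hab : α ≤ β) : KIndLE K X β := by
  rw [kIndLE_iff] at *
  intro F hF hK
  obtain ⟨U, hU, h⟩ := h F hF hK
  exact ⟨U, hU, h.mono hab⟩

theorem kIndLE_of_isEmpty {m : ℕ} {K : Finset (Fin m) → Prop} {X : Type} [TopologicalSpace X]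
    [IsEmpty X] (α : Ordinal.{0}) : KIndLE K X α := by
  rw [kIndLE_iff]
  intro F hF hK
  refine ⟨F, ⟨fun i => ?_, hK, fun i => subset_rfl⟩, Or.inl inferInstance⟩
  rw [Set.eq_empty_of_isEmpty (F i)]
  exact isOpen_empty

theorem KIndLT.le {m : ℕ} {K : Finset (Fin m) → Prop} {X : Type} [TopologicalSpace X]
    {α : Ordinal.{0}} (h : KIndLT K X α) : KIndLE K X α := by
  rcases h with h | ⟨γ, hγ, h⟩
  · exact kIndLE_of_isEmpty α
  · exact h.mono hγ.le

theorem KIndLE.lt {m : ℕ} {K : Finset (Fin m) → Prop} {X : Type} [TopologicalSpace X]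
    {α β : Ordinal.{0}} (h : KIndLE K X α) (hab : α < β) : KIndLT K X β :=
  Or.inr ⟨α, hab, h⟩

theorem kIndLE_of_isClosedEmbedding {m : ℕ} {K : Finset (Fin m) → Prop} (α : Ordinal.{0}) :
    ∀ {A X : Type} [TopologicalSpace A] [TopologicalSpace X] {f : A → X},
      IsClosedEmbedding f → KIndLE K X α → KIndLE K A α := by
  induction α using WellFoundedLT.induction with
  | ind α ih =>
  intro A X _ _ f hf h
  rw [kIndLE_iff] at *
  intro F hF hK
  obtain ⟨U, ⟨hU1, hU2, hU3⟩, h⟩ := h (fun i => f '' F i)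
    (fun i => hf.isClosedMap _ (hF i)) (hK.image hf.injective)
  refine ⟨fun i => f ⁻¹' U i, ⟨fun i => (hU1 i).preimage hf.continuous, hU2.preimage f,
    fun i => Set.image_subset_iff.1 (hU3 i)⟩, ?_⟩
  have e : (⋃ i, f ⁻¹' U i)ᶜ = f ⁻¹' ((⋃ i, U i)ᶜ) := by
    rw [preimage_compl, preimage_iUnion]
  rw [e]
  rcases h with h | ⟨β, hβ, h⟩
  · refine Or.inl ⟨fun a => h.false ⟨f a.1, a.2⟩⟩
  · exact Or.inr ⟨β, hβ, ih β hβ (hf.restrictPreimage _) h⟩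

theorem kIndLT_of_isClosedEmbedding {m : ℕ} {K : Finset (Fin m) → Prop} {α : Ordinal.{0}}
    {A X : Type} [TopologicalSpace A] [TopologicalSpace X] {f : A → X}
    (hf : IsClosedEmbedding f) (h : KIndLT K X α) : KIndLT K A α := by
  rcases h with h | ⟨β, hβ, h⟩
  · exact Or.inl ⟨fun a => h.false (f a)⟩
  · exact Or.inr ⟨β, hβ, kIndLE_of_isClosedEmbedding β hf h⟩

/-- The sum theorem for finitely many clopen pieces, `<`-version from the `≤`-version. -/
theorem kIndLT_sum_aux {m : ℕ} {K : Finset (Fin m) → Prop} (α : Ordinal.{0})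
    (ih : ∀ β, β < α → ∀ {Q D : Type} [TopologicalSpace Q] [Finite D] (c : Q → D),
      (∀ d, IsOpen (c ⁻¹' {d})) → (∀ d, KIndLE K (↥(c ⁻¹' {d})) β) → KIndLE K Q β)
    {Q D : Type} [TopologicalSpace Q] [Finite D] (c : Q → D)
    (hc : ∀ d, IsOpen (c ⁻¹' {d})) (h : ∀ d, KIndLT K (↥(c ⁻¹' {d})) α) : KIndLT K Q α := by
  by_cases hQ : IsEmpty Q
  · exact Or.inl hQ
  rw [not_isEmpty_iff] at hQ
  have h' : ∀ d, ∃ β, β < α ∧ KIndLE K (↥(c ⁻¹' {d})) β := by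
    obtain ⟨q⟩ := hQ
    have hα : 0 < α := by
      rcases h (c q) with h | ⟨β, hβ, -⟩
      · exact (h.false ⟨q, rfl⟩).elim
      · exact (zero_le (a := β)).trans_lt hβ
    intro d
    rcases h d with h | h
    · exact ⟨0, hα, kIndLE_of_isEmpty 0⟩
    · exact h
  choose β hβ hle using h'
  have : Nonempty D := hQ.map c
  obtain ⟨d0, hd0⟩ := Finite.exists_max β
  exact Or.inr ⟨β d0, hβ d0, ih _ (hβ d0) c hc fun d => (hle d).mono (hd0 d)⟩

theorem kIndLE_sum {m : ℕ} {K : Finset (Fin m) → Prop} (α : Ordinal.{0}) :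
    ∀ {Q D : Type} [TopologicalSpace Q] [Finite D] (c : Q → D),
      (∀ d, IsOpen (c ⁻¹' {d})) → (∀ d, KIndLE K (↥(c ⁻¹' {d})) α) → KIndLE K Q α := by
  induction α using WellFoundedLT.induction with
  | ind α ih =>
  intro Q D _ _ c hc h
  rw [kIndLE_iff]
  intro F hF hK
  have h1 : ∀ d, ∃ U : Fin m → Set (↥(c ⁻¹' {d})),
      KNbhd K (fun i => Subtype.val ⁻¹' F i) U ∧ KIndLT K (↥((⋃ i, U i)ᶜ)) α := fun d =>
    (kIndLE_iff.1 (h d)) _ (fun i => (hF i).preimage continuous_subtype_val) (hK.preimage _)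
  choose U hU hlt using h1
  let W : Fin m → Set Q := fun i => {q | (⟨q, rfl⟩ : ↥(c ⁻¹' {c q})) ∈ U (c q) i}
  have hWU : ∀ d (q : ↥(c ⁻¹' {d})) i, q.1 ∈ W i ↔ q ∈ U d i := by
    rintro d ⟨q, rfl⟩ i
    exact Iff.rfl
  have hW : ∀ i, W i = ⋃ d, Subtype.val '' (U d i) := by
    intro i
    ext q
    simp only [mem_iUnion]
    constructor
    · intro hq
      exact ⟨c q, ⟨q, rfl⟩, hq, rfl⟩
    · rintro ⟨d, q, hq, rfl⟩
      exact (hWU d q i).2 hq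
  refine ⟨W, ⟨fun i => ?_, ?_, fun i q hq => (hU (c q)).2.2 i hq⟩, ?_⟩
  · rw [hW]
    exact isOpen_iUnion fun d => (hc d).isOpenMap_subtype_val _ ((hU d).1 i)
  · rw [isKTuple_iff]
    intro q I hI hq
    exact isKTuple_iff.1 (hU (c q)).2.1 ⟨q, rfl⟩ I hI hq
  · refine kIndLT_sum_aux α (fun β hβ => ih β hβ) (fun q : ↥((⋃ i, W i)ᶜ) => c q.1)
      (fun d => (hc d).preimage continuous_subtype_val) fun d => ?_
    have hmem : ∀ q : ↥((fun q : ↥((⋃ i, W i)ᶜ) => c q.1) ⁻¹' {d}),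
        (⟨q.1.1, q.2⟩ : ↥(c ⁻¹' {d})) ∈ (⋃ i, U d i)ᶜ := by
      intro q hq
      obtain ⟨i, hi⟩ := mem_iUnion.1 hq
      exact q.1.2 (mem_iUnion.2 ⟨i, (hWU d ⟨q.1.1, q.2⟩ i).2 hi⟩)
    have hmem' : ∀ q : ↥((⋃ i, U d i)ᶜ), q.1.1 ∈ (⋃ i, W i)ᶜ := by
      intro q hq
      obtain ⟨i, hi⟩ := mem_iUnion.1 hq
      exact q.2 (mem_iUnion.2 ⟨i, (hWU d q.1 i).1 hi⟩)
    let e : ↥((fun q : ↥((⋃ i, W i)ᶜ) => c q.1) ⁻¹' {d}) ≃ₜ ↥((⋃ i, U d i)ᶜ) :=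
      { toFun := fun q => ⟨⟨q.1.1, q.2⟩, hmem q⟩
        invFun := fun q => ⟨⟨q.1.1, hmem' q⟩, q.1.2⟩
        left_inv := fun q => rfl
        right_inv := fun q => rfl
        continuous_toFun := by fun_prop
        continuous_invFun := by fun_prop }
    exact kIndLT_of_isClosedEmbedding e.isClosedEmbedding (hlt d)

theorem kIndLT_sum {m : ℕ} {K : Finset (Fin m) → Prop} {α : Ordinal.{0}}
    {Q D : Type} [TopologicalSpace Q] [Finite D] (c : Q → D)
    (hc : ∀ d, IsOpen (c ⁻¹' {d})) (h : ∀ d, KIndLT K (↥(c ⁻¹' {d})) α) : KIndLT K Q α :=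
  kIndLT_sum_aux α (fun β _ => kIndLE_sum β) c hc h

/-- Selection lemma for profinite spaces. -/
theorem exists_selection {S : Type} [TopologicalSpace S] [CompactSpace S] [T2Space S]
    [TotallyDisconnectedSpace S] (N : S → Set S) (hN : ∀ p, IsOpen (N p)) (hp : ∀ p, p ∈ N p) :
    ∃ (n : ℕ) (c : S → Fin n) (f : Fin n → S), (∀ d, IsClopen (c ⁻¹' {d})) ∧
      ∀ q, q ∈ N (f (c q)) := by
  have hU : TopologicalSpace.IsOpenCover (fun p => (⟨N p, hN p⟩ : TopologicalSpace.Opens S)) := by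
    rw [TopologicalSpace.IsOpenCover]
    ext x
    simp only [TopologicalSpace.Opens.coe_iSup, mem_iUnion]
    exact ⟨fun _ => trivial, fun _ => ⟨x, hp x⟩⟩
  obtain ⟨n, W, h1, h2, h3⟩ := hU.exists_finite_nonempty_disjoint_clopen_cover
  have h2' : ∀ q, ∃ j, q ∈ W j := fun q => by simpa using h2 (mem_univ q)
  choose c hc using h2'
  choose f hf using fun j => (h1 j).2
  refine ⟨n, c, f, fun d => ?_, fun q => hf _ (hc q)⟩
  have : c ⁻¹' {d} = W d := by
    ext q
    constructor
    · rintro rfl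
      exact hc q
    · intro hq
      by_contra hne
      have hd := h3 (show c q ≠ d from hne)
      have hd' : Disjoint (W (c q) : Set S) (W d : Set S) := by
        rw [Set.disjoint_iff_inter_eq_empty, ← TopologicalSpace.Clopens.coe_inf,
          disjoint_iff.1 hd, TopologicalSpace.Clopens.coe_bot]
      exact Set.disjoint_left.1 hd' (hc q) hq
  rw [this]
  exact (W d).isClopen

theorem kIndLE_prod {m : ℕ} {K : Finset (Fin m) → Prop} (α : Ordinal.{0}) :
    ∀ {S Y : Type} [TopologicalSpace S] [TopologicalSpace Y] [CompactSpace S] [T2Space S]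
      [TotallyDisconnectedSpace S] [CompactSpace Y],
      KIndLE K Y α → KIndLE K (S × Y) α := by
  induction α using WellFoundedLT.induction with
  | ind α ih =>
  intro S Y _ _ _ _ _ _ h
  rw [kIndLE_iff]
  intro F hF hK
  have h1 : ∀ s : S, ∃ U : Fin m → Set Y,
      KNbhd K (fun i => (fun y => (s, y)) ⁻¹' F i) U ∧ KIndLT K (↥((⋃ i, U i)ᶜ)) α := fun s =>
    (kIndLE_iff.1 h) _ (fun i => (hF i).preimage (by fun_prop)) (hK.preimage _)
  choose U hU hlt using h1
  let N : S → Set S := fun s => (⋃ i, Prod.fst '' (F i ∩ (Prod.snd ⁻¹' (U s i)ᶜ)))ᶜ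
  have hN : ∀ s, IsOpen (N s) := by
    intro s
    refine (isClosed_iUnion_of_finite fun i => ?_).isOpen_compl
    exact isClosedMap_fst_of_compactSpace _
      ((hF i).inter (((hU s).1 i).isClosed_compl.preimage continuous_snd))
  have hNmem : ∀ s, s ∈ N s := by
    intro s hs
    obtain ⟨i, ⟨s', y⟩, ⟨h1, h2⟩, rfl⟩ := mem_iUnion.1 hs
    exact h2 ((hU s').2.2 i h1)
  obtain ⟨n, c, f, hc, hcf⟩ := exists_selection N hN hNmem
  let W : Fin m → Set (S × Y) := fun i => {p | p.2 ∈ U (f (c p.1)) i}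
  have hW : ∀ i, W i = ⋃ d, (c ⁻¹' {d}) ×ˢ (U (f d) i) := by
    intro i
    ext ⟨s, y⟩
    simp [W]
  refine ⟨W, ⟨fun i => ?_, ?_, ?_⟩, ?_⟩
  · rw [hW]
    exact isOpen_iUnion fun d => (hc d).isOpen.prod ((hU _).1 i)
  · rw [isKTuple_iff]
    intro q I hI hq
    exact isKTuple_iff.1 (hU (f (c q.1))).2.1 q.2 I hI hq
  · rintro i ⟨s, y⟩ hp
    by_contra hn
    exact hcf s (mem_iUnion.2 ⟨i, (s, y), ⟨hp, hn⟩, rfl⟩)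
  · refine kIndLT_sum (fun q : ↥((⋃ i, W i)ᶜ) => c q.1.1)
      (fun d => (hc d).isOpen.preimage (continuous_fst.comp continuous_subtype_val)) fun d => ?_
    have hmem : ∀ q : ↥((fun q : ↥((⋃ i, W i)ᶜ) => c q.1.1) ⁻¹' {d}),
        q.1.1.2 ∈ (⋃ i, U (f d) i)ᶜ := by
      rintro ⟨q, rfl⟩ hq
      obtain ⟨i, hi⟩ := mem_iUnion.1 hq
      exact q.2 (mem_iUnion.2 ⟨i, hi⟩)
    have hmem' : ∀ q : ↥(c ⁻¹' {d}) × ↥((⋃ i, U (f d) i)ᶜ),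
        ((q.1.1, q.2.1) : S × Y) ∈ (⋃ i, W i)ᶜ := by
      rintro ⟨⟨s, rfl⟩, y⟩ hq
      obtain ⟨i, hi⟩ := mem_iUnion.1 hq
      exact y.2 (mem_iUnion.2 ⟨i, hi⟩)
    let e : ↥((fun q : ↥((⋃ i, W i)ᶜ) => c q.1.1) ⁻¹' {d}) ≃ₜ
        ↥(c ⁻¹' {d}) × ↥((⋃ i, U (f d) i)ᶜ) :=
      { toFun := fun q => (⟨q.1.1.1, q.2⟩, ⟨q.1.1.2, hmem q⟩)
        invFun := fun q => ⟨⟨(q.1.1, q.2.1), hmem' q⟩, q.1.2⟩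
        left_inv := fun q => rfl
        right_inv := fun q => rfl
        continuous_toFun := by fun_prop
        continuous_invFun := by fun_prop }
    refine kIndLT_of_isClosedEmbedding e.isClosedEmbedding ?_
    rcases hlt (f d) with h | ⟨β, hβ, h⟩
    · exact Or.inl ⟨fun a => h.false a.2⟩
    · have : CompactSpace ↥(c ⁻¹' {d}) := isCompact_iff_compactSpace.1 (hc d).isClosed.isCompact
      have : CompactSpace ↥((⋃ i, U (f d) i)ᶜ) :=
        isCompact_iff_compactSpace.1
          (isOpen_iUnion fun i => (hU (f d)).1 i).isClosed_compl.isCompact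
      exact Or.inr ⟨β, hβ, ih β hβ h⟩


/-! ### Values of `KInd` -/

theorem kInd_le_iff {m : ℕ} {K : Finset (Fin m) → Prop} {X : Type} [TopologicalSpace X]
    {α : Ordinal.{0}} : KInd K X ≤ Dim.ofOrdinal α ↔ KIndLE K X α := by
  unfold KInd
  split_ifs with h1 h2
  · refine ⟨fun _ => kIndLE_of_isEmpty α, fun _ => ?_⟩
    exact WithTop.coe_le_coe.2 bot_le
  · unfold Dim.ofOrdinal
    rw [WithTop.coe_le_coe, WithBot.coe_le_coe]
    exact ⟨fun h => KIndLE.mono (csInf_mem h2) h, fun h => csInf_le' h⟩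
  · refine ⟨fun h => ?_, fun h => (h2 ⟨α, h⟩).elim⟩
    exact (WithTop.coe_ne_top (top_le_iff.1 h)).elim

theorem kInd_lt_iff {m : ℕ} {K : Finset (Fin m) → Prop} {X : Type} [TopologicalSpace X]
    {α : Ordinal.{0}} : KInd K X < Dim.ofOrdinal α ↔ KIndLT K X α := by
  constructor
  · intro h
    by_cases h1 : IsEmpty X
    · exact Or.inl h1
    by_cases h2 : ∃ α, KIndLE K X α
    · have e : KInd K X = Dim.ofOrdinal (sInf {α | KIndLE K X α}) := by
        unfold KInd
        rw [if_neg h1, if_pos h2]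
      rw [e] at h
      unfold Dim.ofOrdinal at h
      rw [WithTop.coe_lt_coe, WithBot.coe_lt_coe] at h
      exact Or.inr ⟨_, h, csInf_mem h2⟩
    · have e : KInd K X = ⊤ := by
        unfold KInd
        rw [if_neg h1, if_neg h2]
      rw [e] at h
      exact (not_top_lt h).elim
  · rintro (h | ⟨β, hβ, h⟩)
    · unfold KInd
      rw [if_pos h]
      exact WithTop.coe_lt_coe.2 (WithBot.bot_lt_coe α)
    · refine (kInd_le_iff.2 h).trans_lt ?_
      exact WithTop.coe_lt_coe.2 (WithBot.coe_lt_coe.2 hβ)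

theorem kInd_cases {m : ℕ} (K : Finset (Fin m) → Prop) (X : Type) [TopologicalSpace X]
    [Nonempty X] : KInd K X = ⊤ ∨ ∃ α, KInd K X = Dim.ofOrdinal α := by
  unfold KInd
  rw [if_neg (not_isEmpty_iff.2 inferInstance)]
  split_ifs
  · exact Or.inr ⟨_, rfl⟩
  · exact Or.inl rfl

theorem kInd_le_of_isClosedEmbedding {m : ℕ} {K : Finset (Fin m) → Prop}
    {A X : Type} [TopologicalSpace A] [TopologicalSpace X] [Nonempty X] {f : A → X}
    (hf : IsClosedEmbedding f) : KInd K A ≤ KInd K X := by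
  rcases kInd_cases K X with h | ⟨α, h⟩
  · rw [h]; exact le_top
  · rw [h]
    exact kInd_le_iff.2 (kIndLE_of_isClosedEmbedding α hf (kInd_le_iff.1 h.le))

theorem not_kIndLE_zero_vertices (K : Finset (Fin 0) → Prop) (α : Ordinal.{0}) :
    ∀ (X : Type) [TopologicalSpace X] [Nonempty X], ¬ KIndLE K X α := by
  induction α using WellFoundedLT.induction with
  | ind α ih =>
  intro X _ _ h
  obtain ⟨U, -, h⟩ := kIndLE_iff.1 h (fun _ => ∅) (fun _ => isClosed_empty)
    (fun I ⟨i, _⟩ => i.elim0)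
  have hne : Nonempty ↥((⋃ i, U i)ᶜ) := by
    obtain ⟨x⟩ := ‹Nonempty X›
    exact ⟨⟨x, by simp⟩⟩
  rcases h with h | ⟨β, hβ, h⟩
  · exact not_isEmpty_iff.2 hne h
  · exact ih β hβ _ h

/-! ### Swelling, obstruction points and gluing -/

theorem exists_swelling {m : ℕ} {K : Finset (Fin m) → Prop} {X : Type} [TopologicalSpace X]
    [NormalSpace X] (F : Fin m → Set X) (hF : ∀ i, IsClosed (F i)) (hK : IsKTuple K F) :
    ∃ U : Fin m → Set X, (∀ i, IsOpen (U i)) ∧ (∀ i, F i ⊆ U i) ∧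
      IsKTuple K (fun i => closure (U i)) := by
  have key : ∀ t : Finset (Fin m), ∃ G : Fin m → Set X, (∀ i, IsClosed (G i)) ∧ IsKTuple K G ∧
      (∀ i, F i ⊆ G i) ∧ ∀ i ∈ t, F i ⊆ interior (G i) := by
    intro t
    induction t using Finset.induction_on with
    | empty => exact ⟨F, hF, hK, fun i => subset_rfl, by simp⟩
    | insert i t _ ih =>
      obtain ⟨G, h1, h2, h3, h4⟩ := ih
      rw [isKTuple_iff] at h2
      let B : Set X := ⋃ I : {I : Finset (Fin m) // ¬ K (insert i I)}, ⋂ j ∈ I.1 \ {i}, G j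
      have hB : IsClosed B :=
        isClosed_iUnion_of_finite fun I => isClosed_biInter fun j _ => h1 j
      have hGB : G i ⊆ Bᶜ := by
        intro x hx hxB
        obtain ⟨⟨I, hI⟩, hx'⟩ := mem_iUnion.1 hxB
        apply hI
        refine h2 x _ (Finset.insert_nonempty _ _) fun j hj => ?_
        by_cases hji : j = i
        · rw [hji]; exact hx
        · have hjI : j ∈ I := (Finset.mem_insert.1 hj).resolve_left hji
          exact mem_iInter₂.1 hx' j (by simp [hji, hjI])
      obtain ⟨O, hO1, hO2, hO3⟩ := normal_exists_closure_subset (h1 i) hB.isOpen_compl hGB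
      have hle : ∀ j, G j ⊆ Function.update G i (closure O) j := by
        intro j
        by_cases hji : j = i
        · subst hji
          rw [Function.update_self]
          exact hO2.trans subset_closure
        · rw [Function.update_of_ne hji]
      refine ⟨Function.update G i (closure O), fun j => ?_, ?_, fun j => (h3 j).trans (hle j), ?_⟩
      · by_cases hji : j = i
        · subst hji
          rw [Function.update_self]
          exact isClosed_closure
        · rw [Function.update_of_ne hji]
          exact h1 j
      · rw [isKTuple_iff]
        intro x J hJ hx
        by_cases hiJ : i ∈ J
        · by_contra hn
          have hxi := hx i hiJ
          rw [Function.update_self] at hxi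
          apply hO3 hxi
          refine mem_iUnion.2 ⟨⟨J, by rwa [Finset.insert_eq_of_mem hiJ]⟩, ?_⟩
          refine mem_iInter₂.2 fun j hj => ?_
          obtain ⟨hjJ, hji⟩ := Finset.mem_sdiff.1 hj
          have := hx j hjJ
          rwa [Function.update_of_ne (by simpa using hji)] at this
        · refine h2 x J hJ fun j hj => ?_
          have := hx j hj
          have hne : j ≠ i := by
            rintro rfl
            exact hiJ hj
          rwa [Function.update_of_ne hne] at this
      · intro j hj
        by_cases hji : j = i
        · subst hji
          rw [Function.update_self]
          exact (h3 j).trans (hO2.trans (interior_maximal subset_closure hO1))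
        · rw [Function.update_of_ne hji]
          exact h4 j ((Finset.mem_insert.1 hj).resolve_left hji)
  obtain ⟨G, h1, h2, -, h4⟩ := key Finset.univ
  refine ⟨fun i => interior (G i), fun i => isOpen_interior, fun i => h4 i (Finset.mem_univ i),
    h2.mono' fun i => ?_⟩
  exact closure_minimal interior_subset (h1 i)

theorem exists_simplex {m : ℕ} {K : Finset (Fin m) → Prop} (hK : IsComplex K) {X : Type}
    {A : Fin m → Set X} (hA : IsKTuple K A) (i0 : Fin m) (x : X) :
    ∃ T : Finset (Fin m), T.Nonempty ∧ K T ∧ (∀ i, x ∈ A i → i ∈ T) ∧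
      (T = {i0} ∨ ∀ i ∈ T, x ∈ A i) := by
  by_cases h : ((Finset.univ : Finset (Fin m)).filter (fun i => x ∈ A i)).Nonempty
  · refine ⟨_, h, isKTuple_iff.1 hA x _ h (by simp), by simp, Or.inr (by simp)⟩
  · refine ⟨{i0}, Finset.singleton_nonempty _, hK.2 i0, fun i hi => ?_, Or.inl rfl⟩
    exact (h ⟨i, by simpa using hi⟩).elim

theorem kObs_eq_empty_of_closure {m : ℕ} {K : Finset (Fin m) → Prop} (hK : IsComplex K)
    {X : Type} [TopologicalSpace X] {U : Fin m → Set X} (hU : ∀ i, IsOpen (U i))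
    (hcl : IsKTuple K (fun i => closure (U i))) (i0 : Fin m) : KObs K U = ∅ := by
  rw [Set.eq_empty_iff_forall_notMem]
  intro x hx
  apply hx
  obtain ⟨T, ⟨j, hj⟩, hT2, hT3, -⟩ := exists_simplex hK hcl i0 x
  have hUK : IsKTuple K U := hcl.mono' fun i => subset_closure
  let O : Set X := ⋂ i : {i // i ∉ T}, (closure (U i.1))ᶜ
  have hO : IsOpen O := isOpen_iInter_of_finite fun i => isClosed_closure.isOpen_compl
  refine ⟨fun i => if i ∈ T then U i ∪ O else U i, ⟨fun i => ?_, ?_, fun i => ?_⟩, ?_⟩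
  · dsimp only
    split_ifs
    · exact (hU i).union hO
    · exact hU i
  · rw [isKTuple_iff] at *
    intro q I hI hq
    by_cases hqO : q ∈ O
    · refine hK.1 I T (fun i hi => ?_) hI hT2
      by_contra hn
      have h1 := hq i hi
      rw [if_neg hn] at h1
      exact mem_iInter.1 hqO ⟨i, hn⟩ (subset_closure h1)
    · refine hUK q I hI fun i hi => ?_
      have h1 := hq i hi
      split_ifs at h1
      · exact h1.resolve_right hqO
      · exact h1
  · dsimp only
    split_ifs
    · exact subset_union_left
    · exact subset_rfl
  · refine mem_iUnion.2 ⟨j, ?_⟩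
    rw [if_pos hj]
    exact Or.inr (mem_iInter.2 fun i hi => i.2 (hT3 _ hi))

theorem exists_glue {m : ℕ} {X : Type} [TopologicalSpace X] [T2Space X] (S : Set X)
    [CompactSpace S] [TotallyDisconnectedSpace S] (R : X → Set (Fin m) → Prop)
    (h : ∀ p ∈ S, ∃ N : Set X, IsOpen N ∧ p ∈ N ∧ ∃ V : Fin m → Set X, (∀ i, IsOpen (V i)) ∧
      ∀ q ∈ N, R q {i | q ∈ V i}) :
    ∃ O : Fin m → Set X, (∀ i, IsOpen (O i)) ∧ ∀ q ∈ S, R q {i | q ∈ O i} := by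
  choose! N hN1 hN2 V hV1 hV2 using h
  obtain ⟨n, c, f, hc, hcf⟩ := exists_selection (S := S) (fun p => Subtype.val ⁻¹' (N p.1))
    (fun p => (hN1 p.1 p.2).preimage continuous_subtype_val) (fun p => hN2 p.1 p.2)
  have h1 : ∀ i, ∃ O : Set X, IsOpen O ∧
      Subtype.val ⁻¹' O = {q : S | q.1 ∈ V (f (c q)).1 i} := by
    intro i
    rw [← isOpen_induced_iff]
    have e : {q : S | q.1 ∈ V (f (c q)).1 i} =
        ⋃ d, (c ⁻¹' {d}) ∩ (Subtype.val ⁻¹' (V (f d).1 i)) := by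
      ext q
      simp
    rw [e]
    exact isOpen_iUnion fun d => (hc d).isOpen.inter
      ((hV1 _ (f d).2 i).preimage continuous_subtype_val)
  choose O hO1 hO2 using h1
  refine ⟨O, hO1, fun q hq => ?_⟩
  have e : {i | q ∈ O i} = {i | q ∈ V (f (c ⟨q, hq⟩)).1 i} := by
    ext i
    exact Set.ext_iff.1 (hO2 i) ⟨q, hq⟩
  rw [e]
  exact hV2 _ (f (c ⟨q, hq⟩)).2 q (hcf ⟨q, hq⟩)

theorem exists_glue_obs {m : ℕ} {K : Finset (Fin m) → Prop} {X : Type} [TopologicalSpace X]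
    [T2Space X] (S : Set X) [CompactSpace S] [TotallyDisconnectedSpace S]
    (U : Fin m → Set X) (hobs : KObs K U = ∅) :
    ∃ O : Fin m → Set X, (∀ i, IsOpen (O i)) ∧ ∀ q ∈ S, (∀ i, q ∈ U i → q ∈ O i) ∧
      (∃ i, q ∈ O i) ∧ ∀ I : Finset (Fin m), I.Nonempty → (∀ i ∈ I, q ∈ O i) → K I := by
  refine exists_glue S (fun q T => (∀ i, q ∈ U i → i ∈ T) ∧ (∃ i, i ∈ T) ∧
    ∀ I : Finset (Fin m), I.Nonempty → (∀ i ∈ I, i ∈ T) → K I) fun p hp => ?_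
  have hp : p ∉ KObs K U := by rw [hobs]; exact notMem_empty p
  obtain ⟨V, ⟨hV1, hV2, hV3⟩, hV4⟩ := not_not.1 hp
  refine ⟨⋃ i, V i, isOpen_iUnion hV1, hV4, V, hV1, fun q hq => ⟨fun i hi => hV3 i hi, ?_, ?_⟩⟩
  · simpa using hq
  · exact fun I hI h => isKTuple_iff.1 hV2 q I hI h

theorem exists_glue_closure {m : ℕ} {K : Finset (Fin m) → Prop} (hK : IsComplex K)
    {X : Type} [TopologicalSpace X]
    [T2Space X] (S : Set X) [CompactSpace S] [TotallyDisconnectedSpace S] (i0 : Fin m)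
    (U U' : Fin m → Set X) (hU' : ∀ i, IsOpen (U' i))
    (hcl : IsKTuple K (fun i => closure (U i))) (hUU' : ∀ i, closure (U i) ⊆ U' i) :
    ∃ O : Fin m → Set X, (∀ i, IsOpen (O i)) ∧ ∀ q ∈ S, (∀ i, q ∈ U i → q ∈ O i) ∧
      (∃ i, q ∈ O i) ∧ (∀ I : Finset (Fin m), I.Nonempty → (∀ i ∈ I, q ∈ O i) → K I) ∧
      ((∀ i, q ∈ O i → i = i0) ∨ ∀ i, q ∈ O i → q ∈ U' i) := by
  refine exists_glue S (fun q T => (∀ i, q ∈ U i → i ∈ T) ∧ (∃ i, i ∈ T) ∧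
    (∀ I : Finset (Fin m), I.Nonempty → (∀ i ∈ I, i ∈ T) → K I) ∧
    ((∀ i, i ∈ T → i = i0) ∨ ∀ i, i ∈ T → q ∈ U' i)) fun p hp => ?_
  obtain ⟨T, hT1, hT2, hT3, hT4⟩ := exists_simplex hK hcl i0 p
  let N1 : Set X := ⋂ i : {i // i ∉ T}, (closure (U i.1))ᶜ
  have hN1 : IsOpen N1 := isOpen_iInter_of_finite fun i => isClosed_closure.isOpen_compl
  have hpN1 : p ∈ N1 := mem_iInter.2 fun i hi => i.2 (hT3 _ hi)
  let N2 : Set X := ⋂ i : {i // p ∈ closure (U i)}, U' i.1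
  have hN2 : IsOpen N2 := isOpen_iInter_of_finite fun i => hU' _
  have hpN2 : p ∈ N2 := mem_iInter.2 fun i => hUU' _ i.2
  refine ⟨N1 ∩ N2, hN1.inter hN2, ⟨hpN1, hpN2⟩, fun i => {_q | i ∈ T}, fun i => isOpen_const,
    fun q hq => ⟨fun i hi => ?_, hT1, fun I hI h => hK.1 I T (fun i hi => h i hi) hI hT2, ?_⟩⟩
  · by_contra hn
    exact mem_iInter.1 hq.1 ⟨i, hn⟩ (subset_closure hi)
  · rcases hT4 with h | h
    · left
      intro i hi
      have hi' : i ∈ T := hi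
      rw [h] at hi'
      simpa using hi'
    · right
      intro i hi
      exact mem_iInter.1 hq.2 ⟨i, h i hi⟩


/-! ### Abstract description of `Z(X,Y)` -/

/-- The structure maps of the space `Z(X,Y)`. -/
structure ZD (ι X Y Z : Type) [TopologicalSpace ι] [TopologicalSpace X] [TopologicalSpace Y]
    [TopologicalSpace Z] (φ : ι → Set X) where
  a : Z → OnePoint ι
  ca : Continuous a
  pr : Z → X
  cpr : Continuous pr
  e : X → Z
  ce : Continuous e
  a_e : ∀ x, a (e x) = OnePoint.infty
  pr_e : ∀ x, pr (e x) = x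
  e_pr : ∀ z, a z = OnePoint.infty → e (pr z) = z
  g : ι → Z → Y
  cg : ∀ i, Continuous (g i)
  j : ∀ i, ↥(φ i) × Y → Z
  cj : ∀ i, Continuous (j i)
  a_j : ∀ (i : ι) p, a (j i p) = (i : OnePoint ι)
  pr_j : ∀ i p, pr (j i p) = p.1.1
  g_j : ∀ i p, g i (j i p) = p.2
  pr_mem : ∀ (i : ι) z, a z = (i : OnePoint ι) → pr z ∈ φ i
  j_eq : ∀ (i : ι) z (h : a z = (i : OnePoint ι)), j i (⟨pr z, pr_mem i z h⟩, g i z) = z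

namespace ZD

variable {ι X Y Z : Type} [TopologicalSpace ι] [TopologicalSpace X] [TopologicalSpace Y]
    [TopologicalSpace Z] {φ : ι → Set X}

theorem cases (d : ZD ι X Y Z φ) (z : Z) : (∃ x, z = d.e x) ∨ ∃ i p, z = d.j i p := by
  rcases h : d.a z with _ | i
  · exact Or.inl ⟨d.pr z, (d.e_pr z h).symm⟩
  · exact Or.inr ⟨i, _, (d.j_eq i z h).symm⟩

theorem isClosedEmbedding_e (d : ZD ι X Y Z φ) : IsClosedEmbedding d.e := by
  refine ⟨.of_leftInverse (f := d.pr) d.pr_e d.cpr d.ce, ?_⟩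
  have : range d.e = d.a ⁻¹' {OnePoint.infty} := by
    ext z
    constructor
    · rintro ⟨x, rfl⟩
      exact d.a_e x
    · intro h
      exact ⟨_, d.e_pr z h⟩
  rw [this]
  exact OnePoint.isClosed_infty.preimage d.ca

theorem isEmbedding_j (d : ZD ι X Y Z φ) (i : ι) : IsEmbedding (d.j i) := by
  have h1 : IsEmbedding (fun p : ↥(φ i) × Y => ((p.1.1, p.2) : X × Y)) :=
    IsEmbedding.subtypeVal.prodMap .id
  have h2 : (fun p : ↥(φ i) × Y => ((p.1.1, p.2) : X × Y)) =
      (fun z : Z => (d.pr z, d.g i z)) ∘ d.j i := by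
    funext p
    simp [d.pr_j, d.g_j]
  rw [h2] at h1
  exact .of_comp (d.cj i) (d.cpr.prodMk (d.cg i)) h1

theorem range_j (d : ZD ι X Y Z φ) (i : ι) : range (d.j i) = d.a ⁻¹' {(i : OnePoint ι)} := by
  ext z
  constructor
  · rintro ⟨p, rfl⟩
    exact d.a_j i p
  · intro h
    exact ⟨_, d.j_eq i z h⟩

theorem isClopen_fiber [DiscreteTopology ι] (d : ZD ι X Y Z φ) (i : ι) :
    IsClopen (d.a ⁻¹' {(i : OnePoint ι)}) := by
  refine IsClopen.preimage ⟨isClosed_singleton, ?_⟩ d.ca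
  rw [← Set.image_singleton]
  exact OnePoint.isOpen_image_coe.2 (isOpen_discrete _)

theorem isOpenEmbedding_j [DiscreteTopology ι] (d : ZD ι X Y Z φ) (i : ι) :
    IsOpenEmbedding (d.j i) :=
  ⟨d.isEmbedding_j i, by rw [d.range_j]; exact (d.isClopen_fiber i).isOpen⟩

theorem isClosedEmbedding_j [DiscreteTopology ι] (d : ZD ι X Y Z φ) (i : ι) :
    IsClosedEmbedding (d.j i) :=
  ⟨d.isEmbedding_j i, by rw [d.range_j]; exact (d.isClopen_fiber i).isClosed⟩

theorem exists_extension [DiscreteTopology ι] [CompactSpace Z] (d : ZD ι X Y Z φ) {m : ℕ}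
    (F : Fin m → Set Z) (hF : ∀ i, IsClosed (F i))
    (U : Fin m → Set X) (hU : ∀ i, IsOpen (U i)) (hFU : ∀ i, d.e ⁻¹' F i ⊆ U i)
    (O : ι → Fin m → Set X) (hO : ∀ b i, IsOpen (O b i)) (hUO : ∀ b, ∀ x ∈ φ b, ∀ i,
      x ∈ U i → x ∈ O b i)
    (t : ∀ b, Fin m → Set (↥(φ b) × Y)) (ht : ∀ b i, IsOpen (t b i))
    (hFt : ∀ b i, d.j b ⁻¹' F i ⊆ t b i) :
    ∃ (A : Finset ι) (W : Fin m → Set Z), (∀ i, IsOpen (W i)) ∧ (∀ i, F i ⊆ W i) ∧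
      (∀ i x, d.e x ∈ W i ↔ x ∈ U i) ∧ (∀ b ∈ A, ∀ i p, d.j b p ∈ W i ↔ p ∈ t b i) ∧
      (∀ b, b ∉ A → ∀ i p, d.j b p ∈ W i ↔ p.1.1 ∈ O b i) := by
  let C : Set Z := ⋃ i, F i ∩ (d.pr ⁻¹' U i)ᶜ
  have hC : IsClosed C := isClosed_iUnion_of_finite fun i =>
    (hF i).inter ((hU i).preimage d.cpr).isClosed_compl
  obtain ⟨A, hA⟩ := hC.isCompact.elim_finite_subcover (fun b : ι => d.a ⁻¹' {(b : OnePoint ι)})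
    (fun b => (d.isClopen_fiber b).isOpen) (by
      intro z hz
      obtain ⟨i, hz1, hz2⟩ := mem_iUnion.1 hz
      rcases d.cases z with ⟨x, rfl⟩ | ⟨b, p, rfl⟩
      · exact (hz2 (by rw [mem_preimage, d.pr_e]; exact hFU i hz1)).elim
      · exact mem_iUnion.2 ⟨b, d.a_j b p⟩)
  have hAF : ∀ b, b ∉ A → ∀ i p, d.j b p ∈ F i → p.1.1 ∈ U i := by
    intro b hb i p hp
    by_contra hn
    have hz : d.j b p ∈ C := mem_iUnion.2 ⟨i, hp, by rwa [mem_compl_iff, mem_preimage, d.pr_j]⟩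
    obtain ⟨b', hb', h⟩ := mem_iUnion₂.1 (hA hz)
    rw [mem_preimage, d.a_j, mem_singleton_iff, OnePoint.coe_eq_coe] at h
    exact hb (h ▸ hb')
  let G : Set Z := ⋂ b ∈ A, (d.a ⁻¹' {(b : OnePoint ι)})ᶜ
  have hG : IsOpen G := isOpen_biInter_finset fun b _ => (d.isClopen_fiber b).isClosed.isOpen_compl
  let W : Fin m → Set Z := fun i => (d.pr ⁻¹' U i ∩ G) ∪
    ((⋃ b ∈ {b | b ∉ A}, d.pr ⁻¹' O b i ∩ d.a ⁻¹' {(b : OnePoint ι)}) ∪ ⋃ b ∈ A, d.j b '' t b i)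
  have hWe : ∀ i x, d.e x ∈ W i ↔ x ∈ U i := by
    intro i x
    constructor
    · rintro (⟨h, -⟩ | h | h)
      · rwa [mem_preimage, d.pr_e] at h
      · obtain ⟨b, -, -, h⟩ := mem_iUnion₂.1 h
        rw [mem_preimage, d.a_e] at h
        exact (OnePoint.infty_ne_coe b h).elim
      · obtain ⟨b, -, p, -, h⟩ := mem_iUnion₂.1 h
        have := congrArg d.a h
        rw [d.a_e, d.a_j] at this
        exact (OnePoint.coe_ne_infty b this).elim
    · intro h
      refine Or.inl ⟨by rwa [mem_preimage, d.pr_e], mem_iInter₂.2 fun b _ hb => ?_⟩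
      rw [mem_preimage, d.a_e] at hb
      exact OnePoint.infty_ne_coe b hb
  have hWA : ∀ b ∈ A, ∀ i p, d.j b p ∈ W i ↔ p ∈ t b i := by
    intro b hb i p
    constructor
    · rintro (⟨-, h⟩ | h | h)
      · exact (mem_iInter₂.1 h b hb (d.a_j b p)).elim
      · obtain ⟨b', hb', -, h⟩ := mem_iUnion₂.1 h
        rw [mem_preimage, d.a_j, mem_singleton_iff, OnePoint.coe_eq_coe] at h
        exact (hb' (h ▸ hb)).elim
      · obtain ⟨b', -, p', hp', h⟩ := mem_iUnion₂.1 h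
        have := congrArg d.a h
        rw [d.a_j, d.a_j, OnePoint.coe_eq_coe] at this
        subst this
        rwa [(d.isEmbedding_j b').injective h] at hp'
    · intro h
      exact Or.inr (Or.inr (mem_iUnion₂.2 ⟨b, hb, p, h, rfl⟩))
  have hWn : ∀ b, b ∉ A → ∀ i p, d.j b p ∈ W i ↔ p.1.1 ∈ O b i := by
    intro b hb i p
    constructor
    · rintro (⟨h, -⟩ | h | h)
      · rw [mem_preimage, d.pr_j] at h
        exact hUO b _ p.1.2 i h
      · obtain ⟨b', hb', h', h⟩ := mem_iUnion₂.1 h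
        rw [mem_preimage, d.a_j, mem_singleton_iff, OnePoint.coe_eq_coe] at h
        subst h
        rwa [mem_preimage, d.pr_j] at h'
      · obtain ⟨b', hb', p', hp', h⟩ := mem_iUnion₂.1 h
        have := congrArg d.a h
        rw [d.a_j, d.a_j, OnePoint.coe_eq_coe] at this
        exact (hb (this ▸ hb')).elim
    · intro h
      refine Or.inr (Or.inl (mem_iUnion₂.2 ⟨b, hb, ?_, d.a_j b p⟩))
      rwa [mem_preimage, d.pr_j]
  refine ⟨A, W, fun i => ?_, fun i z hz => ?_, hWe, hWA, hWn⟩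
  · refine (((hU i).preimage d.cpr).inter hG).union (IsOpen.union ?_ ?_)
    · exact isOpen_biUnion fun b _ => ((hO b i).preimage d.cpr).inter (d.isClopen_fiber b).isOpen
    · exact isOpen_biUnion fun b _ => (d.isOpenEmbedding_j b).isOpenMap _ (ht b i)
  · rcases d.cases z with ⟨x, rfl⟩ | ⟨b, p, rfl⟩
    · exact (hWe i x).2 (hFU i hz)
    · by_cases hb : b ∈ A
      · exact (hWA b hb i p).2 (hFt b i hz)
      · exact (hWn b hb i p).2 (hUO b _ p.1.2 i (hAF b hb i p hz))

theorem isKTuple_extension (d : ZD ι X Y Z φ) {m : ℕ} {K : Finset (Fin m) → Prop}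
    {U : Fin m → Set X} {O : ι → Fin m → Set X} {t : ∀ b, Fin m → Set (↥(φ b) × Y)}
    {A : Finset ι} {W : Fin m → Set Z}
    (h1 : ∀ i x, d.e x ∈ W i ↔ x ∈ U i) (h2 : ∀ b ∈ A, ∀ i p, d.j b p ∈ W i ↔ p ∈ t b i)
    (h3 : ∀ b, b ∉ A → ∀ i p, d.j b p ∈ W i ↔ p.1.1 ∈ O b i)
    (hU : IsKTuple K U) (ht : ∀ b, IsKTuple K (t b))
    (hO : ∀ b, ∀ q ∈ φ b, ∀ I : Finset (Fin m), I.Nonempty → (∀ i ∈ I, q ∈ O b i) → K I) :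
    IsKTuple K W := by
  rw [isKTuple_iff]
  intro z I hI hz
  rcases d.cases z with ⟨x, rfl⟩ | ⟨b, p, rfl⟩
  · exact isKTuple_iff.1 hU x I hI fun i hi => (h1 i x).1 (hz i hi)
  · by_cases hb : b ∈ A
    · exact isKTuple_iff.1 (ht b) p I hI fun i hi => (h2 b hb i p).1 (hz i hi)
    · exact hO b _ p.1.2 I hI fun i hi => (h3 b hb i p).1 (hz i hi)

theorem kIndLT_partition [DiscreteTopology ι] (d : ZD ι X Y Z φ) {m : ℕ}
    {K : Finset (Fin m) → Prop}
    {U : Fin m → Set X} {O : ι → Fin m → Set X} {t : ∀ b, Fin m → Set (↥(φ b) × Y)}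
    {A : Finset ι} {W : Fin m → Set Z}
    (h1 : ∀ i x, d.e x ∈ W i ↔ x ∈ U i) (h2 : ∀ b ∈ A, ∀ i p, d.j b p ∈ W i ↔ p ∈ t b i)
    (h3 : ∀ b, b ∉ A → ∀ i p, d.j b p ∈ W i ↔ p.1.1 ∈ O b i)
    (hO : ∀ b, ∀ q ∈ φ b, ∃ i, q ∈ O b i) {γ : Ordinal.{0}}
    (hUγ : KIndLT K (↥((⋃ i, U i)ᶜ)) γ) (htγ : ∀ b, KIndLT K (↥((⋃ i, t b i)ᶜ)) γ) :
    KIndLT K (↥((⋃ i, W i)ᶜ)) γ := by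
  let D0 : Set (OnePoint ι) := insert OnePoint.infty ((fun b : ι => (b : OnePoint ι)) '' (A : Set ι))
  have hD0 : D0.Finite := (A.finite_toSet.image _).insert _
  have hmemD : ∀ z : ↥((⋃ i, W i)ᶜ), d.a z.1 ∈ D0 := by
    rintro ⟨z, hz⟩
    rcases d.cases z with ⟨x, rfl⟩ | ⟨b, p, rfl⟩
    · exact Or.inl (d.a_e x)
    · by_cases hb : b ∈ A
      · exact Or.inr ⟨b, hb, (d.a_j b p).symm⟩
      · obtain ⟨i, hi⟩ := hO b _ p.1.2
        exact (hz (mem_iUnion.2 ⟨i, (h3 b hb i p).2 hi⟩)).elim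
  have hfin : Finite ↥D0 := hD0.to_subtype
  let c : ↥((⋃ i, W i)ᶜ) → ↥D0 := fun z => ⟨d.a z.1, hmemD z⟩
  have hcc : Continuous c := (d.ca.comp continuous_subtype_val).subtype_mk _
  have hopen : ∀ o : ↥D0, IsOpen (c ⁻¹' {o}) := by
    have hdisc : DiscreteTopology ↥D0 := inferInstance
    exact fun o => (isOpen_discrete _).preimage hcc
  refine kIndLT_sum c hopen ?_
  rintro ⟨o, ho⟩
  have hz : ∀ z : ↥(c ⁻¹' {⟨o, ho⟩}), d.a z.1.1 = o := fun z => congrArg Subtype.val z.2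
  have hz' : ∀ z : ↥((⋃ i, W i)ᶜ), d.a z.1 = o → z ∈ c ⁻¹' {⟨o, ho⟩} := fun z h => Subtype.ext h
  rcases id ho with rfl | ⟨b, hb, rfl⟩
  · have m1 : ∀ z : ↥(c ⁻¹' {⟨OnePoint.infty, ho⟩}), d.pr z.1.1 ∈ (⋃ i, U i)ᶜ := by
      intro z hx
      obtain ⟨i, hi⟩ := mem_iUnion.1 hx
      refine z.1.2 (mem_iUnion.2 ⟨i, ?_⟩)
      rw [← h1, d.e_pr _ (hz z)] at hi
      exact hi
    have m2 : ∀ x : ↥((⋃ i, U i)ᶜ), d.e x.1 ∈ (⋃ i, W i)ᶜ := by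
      intro x hx
      obtain ⟨i, hi⟩ := mem_iUnion.1 hx
      exact x.2 (mem_iUnion.2 ⟨i, (h1 i _).1 hi⟩)
    have c1 := d.cpr
    have c2 := d.ce
    let h : ↥(c ⁻¹' {⟨OnePoint.infty, ho⟩}) ≃ₜ ↥((⋃ i, U i)ᶜ) :=
      { toFun := fun z => ⟨d.pr z.1.1, m1 z⟩
        invFun := fun x => ⟨⟨d.e x.1, m2 x⟩, hz' _ (d.a_e x.1)⟩
        left_inv := fun z => Subtype.ext (Subtype.ext (d.e_pr _ (hz z)))
        right_inv := fun x => Subtype.ext (d.pr_e _)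
        continuous_toFun := by fun_prop
        continuous_invFun := by fun_prop }
    exact kIndLT_of_isClosedEmbedding h.isClosedEmbedding hUγ
  · have m1 : ∀ z : ↥(c ⁻¹' {⟨(b : OnePoint ι), ho⟩}),
        ((⟨d.pr z.1.1, d.pr_mem b _ (hz z)⟩, d.g b z.1.1) : ↥(φ b) × Y) ∈ (⋃ i, t b i)ᶜ := by
      intro z hx
      obtain ⟨i, hi⟩ := mem_iUnion.1 hx
      refine z.1.2 (mem_iUnion.2 ⟨i, ?_⟩)
      rw [← h2 b hb, d.j_eq b _ (hz z)] at hi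
      exact hi
    have m2 : ∀ x : ↥((⋃ i, t b i)ᶜ), d.j b x.1 ∈ (⋃ i, W i)ᶜ := by
      intro x hx
      obtain ⟨i, hi⟩ := mem_iUnion.1 hx
      exact x.2 (mem_iUnion.2 ⟨i, (h2 b hb i _).1 hi⟩)
    have c1 := d.cpr
    have c2 := d.cj b
    have c3 := d.cg b
    let h : ↥(c ⁻¹' {⟨(b : OnePoint ι), ho⟩}) ≃ₜ ↥((⋃ i, t b i)ᶜ) :=
      { toFun := fun z => ⟨(⟨d.pr z.1.1, d.pr_mem b _ (hz z)⟩, d.g b z.1.1), m1 z⟩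
        invFun := fun x => ⟨⟨d.j b x.1, m2 x⟩, hz' _ (d.a_j b x.1)⟩
        left_inv := fun z => Subtype.ext (Subtype.ext (d.j_eq b _ (hz z)))
        right_inv := fun x =>
          Subtype.ext (Prod.ext (Subtype.ext (d.pr_j b _)) (d.g_j b _))
        continuous_toFun := by fun_prop
        continuous_invFun := by fun_prop }
    exact kIndLT_of_isClosedEmbedding h.isClosedEmbedding (htγ b)

end ZD


/-! ### The main estimates -/

namespace ZD

variable {ι X Y Z : Type} [TopologicalSpace ι] [TopologicalSpace X] [TopologicalSpace Y]
    [TopologicalSpace Z] {φ : ι → Set X}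

theorem kIndLE_of [DiscreteTopology ι] [CompactSpace Z] [T2Space X] [CompactSpace Y]
    (d : ZD ι X Y Z φ) (hφ1 : ∀ b, CompactSpace (φ b)) (hφ2 : ∀ b, TotallyDisconnectedSpace (φ b))
    {m : ℕ} {K : Finset (Fin m) → Prop} {γ : Ordinal.{0}} (hY : KIndLE K Y γ)
    (hX : ∀ F : Fin m → Set X, (∀ i, IsClosed (F i)) → IsKTuple K F →
      ∃ U : Fin m → Set X, KNbhd K F U ∧ KObs K U = ∅ ∧ KIndLT K (↥((⋃ i, U i)ᶜ)) γ) :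
    KIndLE K Z γ := by
  rw [kIndLE_iff]
  intro F hF hK
  obtain ⟨U, ⟨hU1, hU2, hU3⟩, hobs, hUγ⟩ := hX (fun i => d.e ⁻¹' F i)
    (fun i => (hF i).preimage d.ce) (hK.preimage _)
  choose O hO1 hO2 using fun b => exists_glue_obs (K := K) (φ b) U hobs
  have ht : ∀ b, ∃ t : Fin m → Set (↥(φ b) × Y), KNbhd K (fun i => d.j b ⁻¹' F i) t ∧
      KIndLT K (↥((⋃ i, t i)ᶜ)) γ := fun b =>
    kIndLE_iff.1 (kIndLE_prod γ hY) _ (fun i => (hF i).preimage (d.cj b)) (hK.preimage _)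
  choose t ht1 ht2 using ht
  obtain ⟨A, W, hW1, hW2, h1, h2, h3⟩ := d.exists_extension F hF U hU1 hU3 O hO1
    (fun b x hx => (hO2 b x hx).1) t (fun b => (ht1 b).1) (fun b => (ht1 b).2.2)
  refine ⟨W, ⟨hW1, d.isKTuple_extension h1 h2 h3 hU2 (fun b => (ht1 b).2.1)
    (fun b x hx => (hO2 b x hx).2.2), hW2⟩, d.kIndLT_partition h1 h2 h3
    (fun b x hx => (hO2 b x hx).2.1) hUγ ht2⟩

theorem isComplex_bComplex {k : ℕ} (hk : 2 ≤ k) : IsComplex (bComplex k) := by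
  constructor
  · intro s t hst _ ht hs
    apply ht
    rw [Finset.eq_univ_iff_forall] at *
    exact fun i => hst (hs i)
  · intro i h
    have := congrArg Finset.card h
    simp at this
    omega

theorem isKTuple_bComplex {k : ℕ} {X : Type} {A : Fin (k + 1) → Set X} :
    IsKTuple (bComplex k) A ↔ ∀ x, ∃ i, x ∉ A i := by
  rw [isKTuple_iff]
  constructor
  · intro h x
    by_contra! hn
    exact h x Finset.univ ⟨0, Finset.mem_univ 0⟩ (fun i _ => hn i) rfl
  · rintro h x I hI hx rfl
    obtain ⟨i, hi⟩ := h x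
    exact hi (hx i (Finset.mem_univ i))

theorem str_of [DiscreteTopology ι] [CompactSpace Z] [T2Space X] [CompactSpace X]
    [CompactSpace Y] [T2Space Y]
    (d : ZD ι X Y Z φ) (hφ1 : ∀ b, CompactSpace (φ b)) (hφ2 : ∀ b, TotallyDisconnectedSpace (φ b))
    {k : ℕ} (hk : 2 ≤ k) {α : Ordinal.{0}} (hX : KIndLE (bComplex k) X α)
    (hY : KIndLE (bComplex k) Y α)
    (F : Fin (k + 1) → Set Z) (hF : ∀ i, IsClosed (F i)) (hK : IsKTuple (bComplex k) F) :
    ∃ W : Fin (k + 1) → Set Z, KNbhd (bComplex k) F W ∧ KObs (bComplex k) W = ∅ ∧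
      KIndLT (bComplex k) (↥((⋃ i, W i)ᶜ)) (α + 1) := by
  have hc := isComplex_bComplex hk
  obtain ⟨U, hU1, hU2, hU3⟩ := exists_swelling (K := bComplex k) (fun i => d.e ⁻¹' F i)
    (fun i => (hF i).preimage d.ce) (hK.preimage _)
  obtain ⟨U', hU'1, hU'2, hU'3⟩ := exists_swelling (K := bComplex k) (fun i => closure (U i))
    (fun i => isClosed_closure) hU3
  choose O hO1 hO2 using fun b =>
    exists_glue_closure (K := bComplex k) hc (φ b) 0 U U' hU'1 hU3 hU'2
  have ht : ∀ b, ∃ t : Fin (k + 1) → Set (↥(φ b) × Y), (∀ i, IsOpen (t i)) ∧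
      (∀ i, d.j b ⁻¹' F i ⊆ t i) ∧ IsKTuple (bComplex k) (fun i => closure (t i)) := fun b =>
    exists_swelling (fun i => d.j b ⁻¹' F i) (fun i => (hF i).preimage (d.cj b)) (hK.preimage _)
  choose t ht1 ht2 ht3 using ht
  have hα : α < α + 1 := Order.lt_add_one_iff.2 le_rfl
  have hUγ : KIndLT (bComplex k) (↥((⋃ i, U i)ᶜ)) (α + 1) :=
    (kIndLE_of_isClosedEmbedding α
      (isOpen_iUnion hU1).isClosed_compl.isClosedEmbedding_subtypeVal hX).lt hα
  have htγ : ∀ b, KIndLT (bComplex k) (↥((⋃ i, t b i)ᶜ)) (α + 1) := fun b =>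
    (kIndLE_of_isClosedEmbedding α
      (isOpen_iUnion (ht1 b)).isClosed_compl.isClosedEmbedding_subtypeVal
      (kIndLE_prod α hY)).lt hα
  have htK : ∀ b, IsKTuple (bComplex k) (t b) := fun b => (ht3 b).mono' fun i => subset_closure
  obtain ⟨A, W, hW1, hW2, h1, h2, h3⟩ := d.exists_extension F hF U hU1 hU2 O hO1
    (fun b x hx => (hO2 b x hx).1) t ht1 ht2
  have hWK : IsKTuple (bComplex k) W := d.isKTuple_extension h1 h2 h3
    (hU3.mono' fun i => subset_closure) htK (fun b x hx => (hO2 b x hx).2.2.1)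
  refine ⟨W, ⟨hW1, hWK, hW2⟩, ?_, d.kIndLT_partition h1 h2 h3
    (fun b x hx => (hO2 b x hx).2.1) hUγ htγ⟩
  rw [Set.eq_empty_iff_forall_notMem]
  intro z hz
  apply hz
  rcases d.cases z with ⟨x, rfl⟩ | ⟨b, p, rfl⟩
  · -- a point of the copy of `X`
    let N : Set X := ⋂ i : {i // x ∉ closure (U' i)}, (closure (U' i.1))ᶜ
    have hN : IsOpen N := isOpen_iInter_of_finite fun i => isClosed_closure.isOpen_compl
    have hxN : x ∈ N := mem_iInter.2 fun i => i.2
    have hN' : ∀ q ∈ N, ∀ i, q ∈ U' i → x ∈ closure (U' i) := by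
      intro q hq i hi
      by_contra hn
      exact mem_iInter.1 hq ⟨i, hn⟩ (subset_closure hi)
    let G : Set Z := d.pr ⁻¹' N ∩ ⋂ b ∈ A, (d.a ⁻¹' {(b : OnePoint ι)})ᶜ
    have hG : IsOpen G := (hN.preimage d.cpr).inter
      (isOpen_biInter_finset fun b _ => (d.isClopen_fiber b).isClosed.isOpen_compl)
    have hxG : d.e x ∈ G := by
      refine ⟨by rwa [mem_preimage, d.pr_e], mem_iInter₂.2 fun b _ hb => ?_⟩
      rw [mem_preimage, d.a_e] at hb
      exact OnePoint.infty_ne_coe b hb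
    -- the index sets of points of `G`
    have hidx : ∀ q ∈ G, (∀ i, q ∈ W i → i = 0) ∨ ∀ i, q ∈ W i → x ∈ closure (U' i) := by
      rintro q ⟨hq1, hq2⟩
      rcases d.cases q with ⟨x', rfl⟩ | ⟨b, p, rfl⟩
      · right
        intro i hi
        rw [mem_preimage, d.pr_e] at hq1
        exact hN' _ hq1 i (hU'2 i (subset_closure ((h1 i x').1 hi)))
      · have hb : b ∉ A := fun hb => mem_iInter₂.1 hq2 b hb (d.a_j b p)
        rw [mem_preimage, d.pr_j] at hq1
        rcases (hO2 b _ p.1.2).2.2.2 with h | h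
        · left
          exact fun i hi => h i ((h3 b hb i p).1 hi)
        · right
          exact fun i hi => hN' _ hq1 i (h i ((h3 b hb i p).1 hi))
    have hi0 : ∃ i0 : Fin (k + 1), ∀ q ∈ G, ∃ i, i ≠ i0 ∧ q ∉ W i := by
      by_cases hJ : ∃ i, x ∈ closure (U' i)
      · obtain ⟨i0, hi0⟩ := hJ
        refine ⟨i0, fun q hq => ?_⟩
        rcases hidx q hq with h | h
        · obtain ⟨i, hi⟩ : ∃ i : Fin (k + 1), i ∉ ({0, i0} : Finset (Fin (k + 1))) := by
            by_contra! hn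
            have h5 := Finset.card_le_card (fun i _ => hn i :
              (Finset.univ : Finset (Fin (k + 1))) ⊆ {0, i0})
            have h6 := Finset.card_le_two (a := (0 : Fin (k + 1))) (b := i0)
            simp only [Finset.card_univ, Fintype.card_fin] at h5
            omega
          simp only [Finset.mem_insert, Finset.mem_singleton, not_or] at hi
          exact ⟨i, hi.2, fun hq' => hi.1 (h i hq')⟩
        · obtain ⟨i, hi⟩ := isKTuple_bComplex.1 hU'3 x
          exact ⟨i, fun h' => hi (h' ▸ hi0), fun hq' => hi (h i hq')⟩
      · push Not at hJ
        refine ⟨0, fun q hq => ⟨⟨1, by omega⟩, fun h => ?_, fun hq' => ?_⟩⟩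
        · have := congrArg Fin.val h
          simp at this
        · rcases hidx q hq with h | h
          · have := congrArg Fin.val (h _ hq')
            simp at this
          · exact hJ _ (h _ hq')
    obtain ⟨i0, hi0⟩ := hi0
    refine ⟨fun i => if i = i0 then W i ∪ G else W i, ⟨fun i => ?_, ?_, fun i => ?_⟩, ?_⟩
    · dsimp only
      split_ifs
      · exact (hW1 i).union hG
      · exact hW1 i
    · rw [isKTuple_bComplex]
      intro q
      by_cases hq : q ∈ G
      · obtain ⟨i, hi, hqi⟩ := hi0 q hq
        exact ⟨i, by rwa [if_neg hi]⟩
      · obtain ⟨i, hi⟩ := isKTuple_bComplex.1 hWK q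
        refine ⟨i, ?_⟩
        split_ifs
        · exact fun h => h.elim hi hq
        · exact hi
    · dsimp only
      split_ifs
      · exact subset_union_left
      · exact subset_rfl
    · refine mem_iUnion.2 ⟨i0, ?_⟩
      rw [if_pos rfl]
      exact Or.inr hxG
  · by_cases hb : b ∈ A
    · -- a point of one of the finitely many exceptional fibres
      have hobs := kObs_eq_empty_of_closure hc (ht1 b) (ht3 b) 0
      have hp : p ∉ KObs (bComplex k) (t b) := by rw [hobs]; exact notMem_empty p
      obtain ⟨V, ⟨hV1, hV2, hV3⟩, hV4⟩ := not_not.1 hp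
      obtain ⟨i, hi⟩ := mem_iUnion.1 hV4
      refine ⟨fun i => W i ∪ d.j b '' V i, ⟨fun i => (hW1 i).union
        ((d.isOpenEmbedding_j b).isOpenMap _ (hV1 i)), ?_, fun i => subset_union_left⟩,
        mem_iUnion.2 ⟨i, Or.inr ⟨p, hi, rfl⟩⟩⟩
      rw [isKTuple_bComplex]
      intro q
      by_cases hq : ∃ p', q = d.j b p'
      · obtain ⟨p', rfl⟩ := hq
        obtain ⟨i, hi⟩ := isKTuple_bComplex.1 hV2 p'
        refine ⟨i, ?_⟩
        rintro (h | ⟨p'', hp'', h⟩)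
        · exact hi (hV3 i ((h2 b hb i p').1 h))
        · rw [(d.isEmbedding_j b).injective h] at hp''
          exact hi hp''
      · obtain ⟨i, hi⟩ := isKTuple_bComplex.1 hWK q
        refine ⟨i, ?_⟩
        rintro (h | ⟨p'', -, h⟩)
        · exact hi h
        · exact hq ⟨p'', h.symm⟩
    · obtain ⟨i, hi⟩ := (hO2 b _ p.1.2).2.1
      exact ⟨W, ⟨hW1, hWK, fun i => subset_rfl⟩, mem_iUnion.2 ⟨i, (h3 b hb i p).2 hi⟩⟩

end ZD

/-! ### The concrete space -/

theorem isOpen_coe_singleton {ι : Type} [TopologicalSpace ι] [DiscreteTopology ι] (i : ι) :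
    IsOpen ({(i : OnePoint ι)} : Set (OnePoint ι)) := by
  rw [← Set.image_singleton]
  exact OnePoint.isOpen_image_coe.2 (isOpen_discrete _)

theorem continuous_ite_fiber {ι X Y : Type} [TopologicalSpace ι] [DiscreteTopology ι]
    [TopologicalSpace X] [TopologicalSpace Y] (i : ι) (y0 : Y) :
    Continuous (fun p : OnePoint ι × X × Y => if p.1 = (i : OnePoint ι) then p.2.2 else y0) := by
  have hcl : IsClopen {p : OnePoint ι × X × Y | p.1 = (i : OnePoint ι)} :=
    IsClopen.preimage (s := {(i : OnePoint ι)}) ⟨isClosed_singleton, isOpen_coe_singleton i⟩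
      continuous_fst
  refine Continuous.if (fun p hp => ?_) (by fun_prop) (by fun_prop)
  rw [hcl.frontier_eq] at hp
  exact hp.elim

/-- The structure maps of the concrete space `Z(X,Y)`. -/
def zspaceZD (ι X Y : Type) [TopologicalSpace ι] [DiscreteTopology ι] [TopologicalSpace X]
    [TopologicalSpace Y] (φ : ι → Set X) (y0 : Y) : ZD ι X Y (ZSpace ι X Y φ) φ where
  a := fun z => Quot.lift (fun p : OnePoint ι × X × Y => p.1)
    (fun _ _ h => h.1.trans h.2.1.symm) z.1
  ca := (continuous_quot_lift _ continuous_fst).comp continuous_subtype_val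
  pr := fun z => Quot.lift (fun p : OnePoint ι × X × Y => p.2.1) (fun _ _ h => h.2.2) z.1
  cpr := (continuous_quot_lift _ (by fun_prop)).comp continuous_subtype_val
  e := fun x => ⟨Quot.mk _ (OnePoint.infty, x, y0), (OnePoint.infty, x, y0), rfl, Or.inl rfl⟩
  ce := Continuous.subtype_mk (continuous_quot_mk.comp (by fun_prop)) _
  a_e := fun x => rfl
  pr_e := fun x => rfl
  e_pr := by
    rintro ⟨z, hz⟩ h
    induction z using Quot.ind with
    | mk p => exact Subtype.ext (Quot.sound ⟨rfl, h, rfl⟩)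
  g := fun i z => Quot.lift
    (fun p : OnePoint ι × X × Y => if p.1 = (i : OnePoint ι) then p.2.2 else y0)
    (fun p q h => by
      rw [h.1, h.2.1, if_neg (OnePoint.infty_ne_coe i), if_neg (OnePoint.infty_ne_coe i)]) z.1
  cg := fun i => (continuous_quot_lift _ (continuous_ite_fiber i y0)).comp continuous_subtype_val
  j := fun i p => ⟨Quot.mk _ ((i : OnePoint ι), p.1.1, p.2), ((i : OnePoint ι), p.1.1, p.2), rfl,
    Or.inr ⟨i, rfl, p.1.2⟩⟩
  cj := fun i => Continuous.subtype_mk (continuous_quot_mk.comp (by fun_prop)) _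
  a_j := fun i p => rfl
  pr_j := fun i p => rfl
  g_j := fun i p => if_pos rfl
  pr_mem := by
    rintro i ⟨z, p, rfl, h | ⟨i', h1, h2⟩⟩ hz
    · exact (OnePoint.infty_ne_coe i (h.symm.trans hz)).elim
    · have hz' : p.1 = (i : OnePoint ι) := hz
      rw [h1, OnePoint.coe_eq_coe] at hz'
      exact hz' ▸ h2
  j_eq := by
    rintro i ⟨z, hz⟩ h
    induction z using Quot.ind with
    | mk p =>
      have h' : p.1 = (i : OnePoint ι) := h
      refine Subtype.ext ?_
      change Quot.mk _ ((i : OnePoint ι), p.2.1, if p.1 = (i : OnePoint ι) then p.2.2 else y0) = _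
      rw [if_pos h', ← h']

theorem compactSpace_zspace (ι X Y : Type) [TopologicalSpace ι] [DiscreteTopology ι]
    [TopologicalSpace X] [TopologicalSpace Y] [CompactSpace X] [CompactSpace Y] (φ : ι → Set X)
    (hφ : ∀ i, IsClosed (φ i)) : CompactSpace (ZSpace ι X Y φ) := by
  rw [← isCompact_iff_compactSpace]
  let C : Set (OnePoint ι × X × Y) :=
    {p | p.1 = OnePoint.infty ∨ ∃ i : ι, p.1 = (i : OnePoint ι) ∧ p.2.1 ∈ φ i}
  have hC : IsClosed C := by
    have e : Cᶜ = ⋃ i : ι, {p : OnePoint ι × X × Y | p.1 ∈ ({(i : OnePoint ι)} : Set _)} ∩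
        {p | p.2.1 ∈ (φ i)ᶜ} := by
      ext ⟨o, x, y⟩
      rcases o with _ | i
      · constructor
        · intro h
          exact (h (Or.inl rfl)).elim
        · intro h
          obtain ⟨i, h, -⟩ := mem_iUnion.1 h
          exact (OnePoint.infty_ne_coe i h).elim
      · constructor
        · intro h
          exact mem_iUnion.2 ⟨i, rfl, fun hx => h (Or.inr ⟨i, rfl, hx⟩)⟩
        · intro h
          obtain ⟨i', h, hx⟩ := mem_iUnion.1 h
          have hii : i = i' := OnePoint.coe_eq_coe.1 h
          subst hii
          rintro (h' | ⟨i', h', hx'⟩)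
          · exact OnePoint.coe_ne_infty i h'
          · have hii : i = i' := OnePoint.coe_eq_coe.1 h'
            subst hii
            exact hx hx'
    rw [← isOpen_compl_iff, e]
    exact isOpen_iUnion fun i => ((isOpen_coe_singleton i).preimage continuous_fst).inter
      ((hφ i).isOpen_compl.preimage (by fun_prop))
  have e : ZSet ι X Y φ = Quot.mk (ZRel ι X Y) '' C := by
    ext z
    constructor
    · rintro ⟨p, h1, h2⟩
      exact ⟨p, h2, h1⟩
    · rintro ⟨p, h1, h2⟩
      exact ⟨p, h2, h1⟩
  rw [e]
  exact hC.isCompact.image continuous_quot_mk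

theorem sFam_compact {X : Type} [TopologicalSpace X] {S : Set X} (hS : S ∈ SFam X) :
    CompactSpace S := by
  rcases hS with h | ⟨⟨h⟩⟩
  · exact isCompact_iff_compactSpace.1 h.isCompact
  · exact h.symm.compactSpace

theorem sFam_totallyDisconnected {X : Type} [TopologicalSpace X] [T2Space X] {S : Set X}
    (hS : S ∈ SFam X) : TotallyDisconnectedSpace S := by
  rcases hS with h | ⟨⟨h⟩⟩
  · have : Finite S := h
    infer_instance
  · exact h.symm.totallyDisconnectedSpace


-- STATEMENT 16
theorem statement16 (mK : ℕ) (K : Finset (Fin mK) → Prop) (hK : IsComplex K)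
    (X Y : Type) [TopologicalSpace X] [TopologicalSpace Y]
    [CompactSpace X] [CompactSpace Y] [T2Space X] [T2Space Y] [Nonempty X] [Nonempty Y]
    (ι : Type) [TopologicalSpace ι] [DiscreteTopology ι]
    (hι : ZCardOK X Y ι) (φ : ι → Set X) (hφ : ZPhiOK φ) :
    KInd K (ZSpace ι X Y φ) ≤ max (KInd K X + 1) (KInd K Y) ∧
    (KStr K X = 0 → KInd K (ZSpace ι X Y φ) = max (KInd K X) (KInd K Y)) ∧
    (∀ k : ℕ, 2 ≤ k →
      KInd (bComplex k) Y < KInd (bComplex k) X + 1 →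
      KInd (bComplex k) X + 1 = KInd (bComplex k) (ZSpace ι X Y φ) →
      KStr (bComplex k) (ZSpace ι X Y φ) = 0) := by
  have hφ1 : ∀ b, CompactSpace (φ b) := fun b => sFam_compact (hφ.1 b)
  have hφ2 : ∀ b, TotallyDisconnectedSpace (φ b) := fun b => sFam_totallyDisconnected (hφ.1 b)
  have hZ : CompactSpace (ZSpace ι X Y φ) := compactSpace_zspace ι X Y φ
    fun b => (isCompact_iff_compactSpace.2 (hφ1 b)).isClosed
  obtain ⟨y0⟩ := id ‹Nonempty Y›
  obtain ⟨x0⟩ := id ‹Nonempty X›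
  let d : ZD ι X Y (ZSpace ι X Y φ) φ := zspaceZD ι X Y φ y0
  have hZne : Nonempty (ZSpace ι X Y φ) := ⟨d.e x0⟩
  refine ⟨?_, ?_, ?_⟩
  · rcases kInd_cases K X with hX | ⟨α, hX⟩
    · rw [hX, WithTop.top_add]
      exact le_max_of_le_left le_top
    rcases kInd_cases K Y with hY | ⟨β, hY⟩
    · rw [hY]
      exact le_max_of_le_right le_top
    have hX' : KIndLE K X α := kInd_le_iff.1 hX.le
    have hY' : KIndLE K Y β := kInd_le_iff.1 hY.le
    have e : KInd K X + 1 = Dim.ofOrdinal (α + 1) := by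
      rw [hX]
      rfl
    have hle : KIndLE K (ZSpace ι X Y φ) (max (α + 1) β) := by
      refine d.kIndLE_of hφ1 hφ2 (hY'.mono (le_max_right _ _)) fun F hF hFK => ?_
      rcases mK with _ | n
      · exact (not_kIndLE_zero_vertices K α X hX').elim
      obtain ⟨U, hU1, hU2, hU3⟩ := exists_swelling F hF hFK
      refine ⟨U, ⟨hU1, hU3.mono' fun i => subset_closure, hU2⟩,
        kObs_eq_empty_of_closure hK hU1 hU3 0, ?_⟩
      refine (kIndLE_of_isClosedEmbedding α
        (isOpen_iUnion hU1).isClosed_compl.isClosedEmbedding_subtypeVal hX').lt ?_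
      exact (Order.lt_add_one_iff.2 le_rfl).trans_le (le_max_left _ _)
    rw [e, hY]
    rcases max_cases (α + 1) β with ⟨h, -⟩ | ⟨h, -⟩
    · rw [h] at hle
      exact (kInd_le_iff.2 hle).trans (le_max_left _ _)
    · rw [h] at hle
      exact (kInd_le_iff.2 hle).trans (le_max_right _ _)
  · intro hstr
    have hlow : max (KInd K X) (KInd K Y) ≤ KInd K (ZSpace ι X Y φ) := by
      refine max_le (kInd_le_of_isClosedEmbedding d.isClosedEmbedding_e) ?_
      have hne : Nonempty ↥(φ ⁻¹' {({x0} : Set X)}) := by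
        rw [← Cardinal.mk_ne_zero_iff, hφ.2 _ (Or.inl (Set.finite_singleton x0))]
        exact (Cardinal.aleph0_pos.trans_le hι.1).ne'
      obtain ⟨b, hb⟩ := hne
      have hxb : x0 ∈ φ b := by
        have hb' : φ b = {x0} := hb
        rw [hb']
        rfl
      refine kInd_le_of_isClosedEmbedding (f := d.j b ∘ fun y => (⟨x0, hxb⟩, y)) ?_
      refine (d.isClosedEmbedding_j b).comp ?_
      exact Continuous.isClosedEmbedding (by fun_prop) fun y y' h => congrArg Prod.snd h
    refine le_antisymm ?_ hlow
    rcases kInd_cases K X with hX | ⟨α, hX⟩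
    · rw [hX]
      exact le_max_of_le_left le_top
    rcases kInd_cases K Y with hY | ⟨β, hY⟩
    · rw [hY]
      exact le_max_of_le_right le_top
    have hX' : KIndLE K X α := kInd_le_iff.1 hX.le
    have hY' : KIndLE K Y β := kInd_le_iff.1 hY.le
    have hns : ¬ KStrongly K X := by
      intro h
      unfold KStr at hstr
      rw [if_pos h] at hstr
      exact one_ne_zero hstr
    have hle : KIndLE K (ZSpace ι X Y φ) (max α β) := by
      refine d.kIndLE_of hφ1 hφ2 (hY'.mono (le_max_right _ _)) fun F hF hFK => ?_
      rcases eq_or_ne α 0 with h0 | h0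
      · subst h0
        obtain ⟨U, hU, h⟩ := kIndLE_iff.1 hX' F hF hFK
        rcases h with h | ⟨β, hβ, -⟩
        · refine ⟨U, hU, ?_, Or.inl h⟩
          rw [Set.eq_empty_iff_forall_notMem]
          intro x hx
          refine hx ⟨U, ⟨hU.1, hU.2.1, fun i => subset_rfl⟩, ?_⟩
          by_contra hn
          exact h.false ⟨x, hn⟩
        · exact (not_lt_zero hβ).elim
      · by_contra hn
        apply hns
        refine ⟨⟨α, pos_iff_ne_zero.2 h0, hX⟩, F, hF, hFK, fun U hU hlt hobs => hn ?_⟩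
        rw [hX] at hlt
        exact ⟨U, hU, hobs, (kInd_lt_iff.1 hlt).mono (le_max_left _ _)⟩
    rw [hX, hY]
    rcases max_cases α β with ⟨h, -⟩ | ⟨h, -⟩
    · rw [h] at hle
      exact (kInd_le_iff.2 hle).trans (le_max_left _ _)
    · rw [h] at hle
      exact (kInd_le_iff.2 hle).trans (le_max_right _ _)
  · intro k hk hYX hXZ
    unfold KStr
    rw [if_neg]
    rintro ⟨⟨δ, -, hδ⟩, F, hF, hFK, h⟩
    rcases kInd_cases (bComplex k) X with hX | ⟨α, hX⟩
    · rw [hX, WithTop.top_add, hδ] at hXZ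
      exact (WithTop.coe_ne_top hXZ.symm).elim
    have e : KInd (bComplex k) X + 1 = Dim.ofOrdinal (α + 1) := by
      rw [hX]
      rfl
    have hX' : KIndLE (bComplex k) X α := kInd_le_iff.1 hX.le
    have hY' : KIndLE (bComplex k) Y α := by
      rw [e, kInd_lt_iff] at hYX
      rcases hYX with h | ⟨β, hβ, h⟩
      · exact kIndLE_of_isEmpty α
      · exact h.mono (Order.lt_add_one_iff.1 hβ)
    obtain ⟨W, hW1, hW2, hW3⟩ := d.str_of hφ1 hφ2 hk hX' hY' F hF hFK
    refine h W hW1 ?_ hW2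
    rw [← hXZ, e]
    exact kInd_lt_iff.2 hW3

end
end

section
/- Let k ≥ 1, and suppose X and Y are non-empty compact (Hausdorff) spaces with X Fréchet. If ∂Δ^k-str X = 1 and ∂Δ^k-Ind X = ∂Δ^k-Ind Y, then ∂Δ^k-Ind Z(X,Y) = ∂Δ^k-Ind X + 1. -/
open Set Topology Cardinal

noncomputable section

attribute [local instance] Classical.propDecidable

namespace S17

lemma isKTuple_iff {k : ℕ} {X : Type} (A : Fin (k + 1) → Set X) :
    IsKTuple (bComplex k) A ↔ (⋂ i, A i) = ∅ := by
  constructor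
  · intro h
    by_contra hne
    have := h Finset.univ Finset.univ_nonempty
      (by simpa [Set.nonempty_iff_ne_empty] using hne)
    exact this rfl
  · intro h I _ hI hu
    subst hu
    simp only [Finset.mem_univ, Set.iInter_true] at hI
    rw [h] at hI
    exact Set.not_nonempty_empty hI

/-- Relative version of `K-Ind A ≤ α` for closed subsets of an ambient space. -/
def RLE (k : ℕ) {Z : Type} [TopologicalSpace Z] (α : Ordinal.{0}) (A : Set Z) : Prop :=
  ∀ F : Fin (k + 1) → Set Z, (∀ i, IsClosed (F i)) → (∀ i, F i ⊆ A) → (⋂ i, F i) = ∅ →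
    ∃ U : Fin (k + 1) → Set Z, (∀ i, IsOpen (U i)) ∧ (∀ i, F i ⊆ U i) ∧
      (A ∩ ⋂ i, U i) = ∅ ∧
      ((A \ ⋃ i, U i) = ∅ ∨ ∃ β, ∃ _ : β < α, RLE k β (A \ ⋃ i, U i))
termination_by α

/-- Relative version of `K-Ind A < α`. -/
def RLT (k : ℕ) {Z : Type} [TopologicalSpace Z] (α : Ordinal.{0}) (A : Set Z) : Prop :=
  A = ∅ ∨ ∃ β, β < α ∧ RLE k β A

lemma rle_iff {k : ℕ} {Z : Type} [TopologicalSpace Z] {α : Ordinal.{0}} {A : Set Z} :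
    RLE k α A ↔
  ∀ F : Fin (k + 1) → Set Z, (∀ i, IsClosed (F i)) → (∀ i, F i ⊆ A) → (⋂ i, F i) = ∅ →
    ∃ U : Fin (k + 1) → Set Z, (∀ i, IsOpen (U i)) ∧ (∀ i, F i ⊆ U i) ∧
      (A ∩ ⋂ i, U i) = ∅ ∧ RLT k α (A \ ⋃ i, U i) := by
  rw [RLE]
  simp only [RLT, exists_prop]

lemma kindle_iff {k : ℕ} {X : Type} [tX : TopologicalSpace X] {α : Ordinal.{0}} :
    KIndLE (bComplex k) X α ↔
    ∀ F : Fin (k + 1) → Set X, (∀ i, IsClosed (F i)) → (⋂ i, F i) = ∅ →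
      ∃ U : Fin (k + 1) → Set X, (∀ i, IsOpen (U i)) ∧ (⋂ i, U i) = ∅ ∧ (∀ i, F i ⊆ U i) ∧
        ((⋃ i, U i)ᶜ = (∅ : Set X) ∨
          ∃ β, β < α ∧ KIndLE (bComplex k) (↥((⋃ i, U i)ᶜ)) β) := by
  unfold KIndLE KIndLeAux
  rw [WellFounded.fix_eq]
  simp only [isKTuple_iff]
  constructor
  · intro h F h1 h2
    obtain ⟨U, a, b, c, d⟩ := h F h1 h2
    refine ⟨U, a, b, c, d.imp id ?_⟩
    rintro ⟨β, hβ⟩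
    exact ⟨β.1, β.2, hβ⟩
  · intro h F h1 h2
    obtain ⟨U, a, b, c, d⟩ := h F h1 h2
    refine ⟨U, a, b, c, d.imp id ?_⟩
    rintro ⟨β, h, hβ⟩
    exact ⟨⟨β, h⟩, hβ⟩

lemma rlt_mono_ord {k : ℕ} {Z : Type} [TopologicalSpace Z] {α β : Ordinal.{0}} {A : Set Z}
    (h : α ≤ β) (hA : RLT k α A) : RLT k β A := by
  rcases hA with hA | ⟨γ, hγ, hA⟩
  · exact Or.inl hA
  · exact Or.inr ⟨γ, hγ.trans_le h, hA⟩

lemma rle_mono_ord {k : ℕ} {Z : Type} [TopologicalSpace Z] {α β : Ordinal.{0}} {A : Set Z}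
    (h : α ≤ β) (hA : RLE k α A) : RLE k β A := by
  rw [rle_iff] at hA ⊢
  intro F h1 h2 h3
  obtain ⟨U, a, b, c, d⟩ := hA F h1 h2 h3
  exact ⟨U, a, b, c, rlt_mono_ord h d⟩

/-- `KIndLE` of a space is the relative version of the image in any closed embedding. -/
lemma kindle_iff_rle {k : ℕ} {Z : Type} [TopologicalSpace Z] {α : Ordinal.{0}} :
    ∀ {T : Type} [TopologicalSpace T] (e : T → Z), IsClosedEmbedding e →
      (KIndLE (bComplex k) T α ↔ RLE k α (range e)) := by
  induction α using WellFoundedLT.induction with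
  | ind α ih =>
  intro T _ e he
  have himg : ∀ U : Fin (k + 1) → Set Z,
      e '' (⋃ i, e ⁻¹' U i)ᶜ = range e \ ⋃ i, U i := by
    intro U
    ext z; constructor
    · rintro ⟨t, ht, rfl⟩
      simpa using ht
    · rintro ⟨⟨t, rfl⟩, ht⟩
      exact ⟨t, by simpa using ht, rfl⟩
  have key : ∀ U : Fin (k + 1) → Set Z, (∀ i, IsOpen (U i)) → ∀ β < α,
      (KIndLE (bComplex k) (↥((⋃ i, e ⁻¹' U i)ᶜ)) β ↔ RLE k β (range e \ ⋃ i, U i)) := by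
    intro U hU β hβ
    have ho : IsClosed ((⋃ i, e ⁻¹' U i)ᶜ) :=
      (isOpen_iUnion fun i => (hU i).preimage he.continuous).isClosed_compl
    rw [ih β hβ (e ∘ Subtype.val) (he.comp ho.isClosedEmbedding_subtypeVal)]
    rw [range_comp, Subtype.range_val, himg]
  rw [kindle_iff, rle_iff]
  constructor
  · intro h F hF hFA hF0
    obtain ⟨U, hU, hU0, hFU, hd⟩ := h (fun i => e ⁻¹' F i)
      (fun i => (hF i).preimage he.continuous)
      (by rw [← preimage_iInter, hF0, preimage_empty])
    have : ∀ i, ∃ V : Set Z, IsOpen V ∧ e ⁻¹' V = U i := fun i =>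
      he.isInducing.isOpen_iff.1 (hU i)
    choose V hV hVU using this
    obtain rfl : (fun i => e ⁻¹' V i) = U := funext hVU
    refine ⟨V, hV, ?_, ?_, ?_⟩
    · intro i z hz
      obtain ⟨t, rfl⟩ := hFA i hz
      exact hFU i hz
    · rw [← preimage_iInter] at hU0
      rw [Set.eq_empty_iff_forall_notMem] at hU0 ⊢
      rintro z ⟨⟨t, rfl⟩, ht⟩
      exact hU0 t ht
    · rcases hd with hd | ⟨β, hβ, hd⟩
      · left; rw [← himg, hd, image_empty]
      · exact Or.inr ⟨β, hβ, (key V hV β hβ).1 hd⟩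
  · intro h F hF hF0
    obtain ⟨V, hV, hFV, hV0, hd⟩ := h (fun i => e '' F i)
      (fun i => he.isClosedMap _ (hF i)) (fun i => image_subset_range _ _)
      (by rw [← he.injective.injOn.image_iInter_eq, hF0, image_empty])
    refine ⟨fun i => e ⁻¹' V i, fun i => (hV i).preimage he.continuous, ?_, ?_, ?_⟩
    · rw [← preimage_iInter]
      rw [Set.eq_empty_iff_forall_notMem] at hV0 ⊢
      exact fun t ht => hV0 (e t) ⟨⟨t, rfl⟩, ht⟩
    · exact fun i => image_subset_iff.1 (hFV i)
    · rcases hd with hd | ⟨β, hβ, hd⟩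
      · left; rw [← himg, image_eq_empty] at hd; exact hd
      · exact Or.inr ⟨β, hβ, (key V hV β hβ).2 hd⟩

lemma rle_image_iff {k : ℕ} {Z T : Type} [TopologicalSpace Z] [TopologicalSpace T]
    {α : Ordinal.{0}} (e : T → Z) (he : IsClosedEmbedding e) {C : Set T} (hC : IsClosed C) :
    RLE k α (e '' C) ↔ RLE k α C := by
  have h1 := kindle_iff_rle (k := k) (α := α) (e ∘ ((↑) : C → T))
    (he.comp hC.isClosedEmbedding_subtypeVal)
  have h2 := kindle_iff_rle (k := k) (α := α) ((↑) : C → T) hC.isClosedEmbedding_subtypeVal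
  rw [range_comp, Subtype.range_val] at h1
  rw [Subtype.range_val] at h2
  rw [← h1, h2]

lemma rlt_image_iff {k : ℕ} {Z T : Type} [TopologicalSpace Z] [TopologicalSpace T]
    {α : Ordinal.{0}} (e : T → Z) (he : IsClosedEmbedding e) {C : Set T} (hC : IsClosed C) :
    RLT k α (e '' C) ↔ RLT k α C := by
  simp only [RLT, rle_image_iff e he hC, image_eq_empty]

lemma rle_mono {k : ℕ} {Z : Type} [TopologicalSpace Z] {α : Ordinal.{0}} :
    ∀ {A B : Set Z}, B ⊆ A → RLE k α A → RLE k α B := by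
  induction α using WellFoundedLT.induction with
  | ind α ih =>
  intro A B hBA hA
  rw [rle_iff] at hA ⊢
  intro F h1 h2 h3
  obtain ⟨U, a, b, c, d⟩ := hA F h1 (fun i => (h2 i).trans hBA) h3
  refine ⟨U, a, b, subset_empty_iff.1 (c ▸ inter_subset_inter_left _ hBA), ?_⟩
  have hs : B \ ⋃ i, U i ⊆ A \ ⋃ i, U i := sdiff_subset_sdiff_left hBA
  rcases d with d | ⟨β, hβ, d⟩
  · exact Or.inl (subset_empty_iff.1 (d ▸ hs))
  · exact Or.inr ⟨β, hβ, ih β hβ hs d⟩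

lemma rlt_mono {k : ℕ} {Z : Type} [TopologicalSpace Z] {α : Ordinal.{0}}
    {A B : Set Z} (hBA : B ⊆ A) (hA : RLT k α A) : RLT k α B := by
  rcases hA with d | ⟨β, hβ, d⟩
  · exact Or.inl (subset_empty_iff.1 (d ▸ hBA))
  · exact Or.inr ⟨β, hβ, rle_mono hBA d⟩

lemma rlt_union_aux {k : ℕ} {Z : Type} [TopologicalSpace Z] {α : Ordinal.{0}}
    (H : ∀ β < α, ∀ {A B : Set Z}, IsClosed A → IsClosed B → Disjoint A B →
      RLE k β A → RLE k β B → RLE k β (A ∪ B))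
    {A B : Set Z} (hA : IsClosed A) (hB : IsClosed B) (hd : Disjoint A B)
    (h1 : RLT k α A) (h2 : RLT k α B) : RLT k α (A ∪ B) := by
  rcases h1 with rfl | ⟨β, hβ, h1⟩
  · simpa using h2
  rcases h2 with rfl | ⟨γ, hγ, h2⟩
  · rw [union_empty]; exact Or.inr ⟨β, hβ, h1⟩
  exact Or.inr ⟨max β γ, max_lt hβ hγ, H _ (max_lt hβ hγ) hA hB hd
    (rle_mono_ord (le_max_left _ _) h1) (rle_mono_ord (le_max_right _ _) h2)⟩

lemma rle_union {k : ℕ} {Z : Type} [TopologicalSpace Z] [NormalSpace Z] {α : Ordinal.{0}} :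
    ∀ {A B : Set Z}, IsClosed A → IsClosed B → Disjoint A B →
      RLE k α A → RLE k α B → RLE k α (A ∪ B) := by
  induction α using WellFoundedLT.induction with
  | ind α ih =>
  intro A B hA hB hd h1 h2
  rw [rle_iff] at h1 h2 ⊢
  intro F hF hFs hF0
  obtain ⟨U, a, b, c, d⟩ := h1 (fun i => F i ∩ A) (fun i => (hF i).inter hA)
    (fun i => inter_subset_right)
    (subset_empty_iff.1 (hF0 ▸ iInter_mono fun i => inter_subset_left))
  obtain ⟨V, a', b', c', d'⟩ := h2 (fun i => F i ∩ B) (fun i => (hF i).inter hB)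
    (fun i => inter_subset_right)
    (subset_empty_iff.1 (hF0 ▸ iInter_mono fun i => inter_subset_left))
  obtain ⟨O, O', hO, hO', hAO, hBO, hOO⟩ := normal_separation hA hB hd
  rw [Set.disjoint_left] at hOO
  refine ⟨fun i => (U i ∩ O) ∪ (V i ∩ O'),
    fun i => ((a i).inter hO).union ((a' i).inter hO'), ?_, ?_, ?_⟩
  · intro i z hz
    rcases hFs i hz with h | h
    · exact Or.inl ⟨b i ⟨hz, h⟩, hAO h⟩
    · exact Or.inr ⟨b' i ⟨hz, h⟩, hBO h⟩
  · rw [Set.eq_empty_iff_forall_notMem] at c c' ⊢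
    rintro z ⟨h | h, hz⟩ <;> rw [mem_iInter] at hz
    · refine c z ⟨h, mem_iInter.2 fun i => ?_⟩
      rcases hz i with hh | hh
      · exact hh.1
      · exact (hOO (hAO h) hh.2).elim
    · refine c' z ⟨h, mem_iInter.2 fun i => ?_⟩
      rcases hz i with hh | hh
      · exact (hOO hh.2 (hBO h)).elim
      · exact hh.1
  · have hsub : ((A ∪ B) \ ⋃ i, ((U i ∩ O) ∪ (V i ∩ O'))) ⊆
        (A \ ⋃ i, U i) ∪ (B \ ⋃ i, V i) := by
      rintro z ⟨h | h, hz⟩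
      · refine Or.inl ⟨h, fun hh => hz ?_⟩
        obtain ⟨i, hi⟩ := mem_iUnion.1 hh
        exact mem_iUnion.2 ⟨i, Or.inl ⟨hi, hAO h⟩⟩
      · refine Or.inr ⟨h, fun hh => hz ?_⟩
        obtain ⟨i, hi⟩ := mem_iUnion.1 hh
        exact mem_iUnion.2 ⟨i, Or.inr ⟨hi, hBO h⟩⟩
    refine rlt_mono hsub (rlt_union_aux (fun β hβ A B => ih β hβ) ?_ ?_ ?_ d d')
    · exact hA.sdiff (isOpen_iUnion a)
    · exact hB.sdiff (isOpen_iUnion a')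
    · exact hd.mono sdiff_subset sdiff_subset

lemma rlt_union {k : ℕ} {Z : Type} [TopologicalSpace Z] [NormalSpace Z] {α : Ordinal.{0}}
    {A B : Set Z} (hA : IsClosed A) (hB : IsClosed B) (hd : Disjoint A B)
    (h1 : RLT k α A) (h2 : RLT k α B) : RLT k α (A ∪ B) :=
  rlt_union_aux (fun _ _ _ _ => rle_union) hA hB hd h1 h2

lemma rlt_biUnion {k : ℕ} {Z : Type} [TopologicalSpace Z] [NormalSpace Z] {α : Ordinal.{0}}
    {ι : Type} {E : Set ι} (hE : E.Finite) (A : ι → Set Z) (hA : ∀ i ∈ E, IsClosed (A i))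
    (hd : ∀ i j, i ≠ j → Disjoint (A i) (A j)) (h : ∀ i ∈ E, RLT k α (A i)) :
    RLT k α (⋃ i ∈ E, A i) := by
  induction E, hE using Set.Finite.induction_on with
  | empty => left; simp
  | @insert a s ha hs ih =>
    rw [biUnion_insert]
    refine rlt_union (hA a (by simp)) (hs.isClosed_biUnion fun i hi => hA i (by simp [hi])) ?_
      (h a (by simp)) (ih (fun i hi => hA i (by simp [hi])) (fun i hi => h i (by simp [hi])))
    refine Set.disjoint_iUnion₂_right.2 fun i hi => hd a i ?_
    rintro rfl; exact ha hi

/-! ### Products with a zero-dimensional compact space -/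

lemma rle_prod {k : ℕ} {S Y : Type} [TopologicalSpace S] [TopologicalSpace Y] [CompactSpace S]
    [T2Space S] [TotallyDisconnectedSpace S] [CompactSpace Y] [T2Space Y] {α : Ordinal.{0}} :
    ∀ {C : Set Y}, IsClosed C → RLE k α C → RLE k α ((Set.univ : Set S) ×ˢ C) := by
  induction α using WellFoundedLT.induction with
  | ind α ih =>
  intro C hC h
  rw [rle_iff] at h ⊢
  intro G hG hGC hG0
  let Good : Set S → Prop := fun O => ∃ U : Fin (k + 1) → Set (S × Y), (∀ i, IsOpen (U i)) ∧
    (∀ i, G i ∩ (O ×ˢ Set.univ) ⊆ U i) ∧ ((O ×ˢ C) ∩ ⋂ i, U i) = ∅ ∧ RLT k α ((O ×ˢ C) \ ⋃ i, U i)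
  have good_mono : ∀ O O', O ⊆ O' → Good O' → Good O := by
    rintro O O' hO ⟨U, a, b, c, d⟩
    refine ⟨U, a, fun i => (inter_subset_inter_right _ (prod_mono_left hO)).trans (b i),
      subset_empty_iff.1 (c ▸ inter_subset_inter_left _ (prod_mono_left hO)),
      rlt_mono (sdiff_subset_sdiff_left (prod_mono_left hO)) d⟩
  have good_union : ∀ O O', IsClopen O → IsClopen O' → Disjoint O O' → Good O → Good O' →
      Good (O ∪ O') := by
    rintro O O' hO hO' hd ⟨U, a, b, c, d⟩ ⟨V, a', b', c', d'⟩
    rw [Set.disjoint_left] at hd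
    refine ⟨fun i => (U i ∩ (O ×ˢ Set.univ)) ∪ (V i ∩ (O' ×ˢ Set.univ)), fun i =>
      ((a i).inter (hO.isOpen.prod isOpen_univ)).union
        ((a' i).inter (hO'.isOpen.prod isOpen_univ)), ?_, ?_, ?_⟩
    · rintro i ⟨s, y⟩ ⟨hz, h | h, -⟩
      · exact Or.inl ⟨b i ⟨hz, h, trivial⟩, h, trivial⟩
      · exact Or.inr ⟨b' i ⟨hz, h, trivial⟩, h, trivial⟩
    · rw [Set.eq_empty_iff_forall_notMem] at c c' ⊢
      rintro ⟨s, y⟩ ⟨⟨h | h, hy⟩, hz⟩ <;> rw [mem_iInter] at hz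
      · refine c (s, y) ⟨⟨h, hy⟩, mem_iInter.2 fun i => ?_⟩
        rcases hz i with hh | hh
        · exact hh.1
        · exact (hd h hh.2.1).elim
      · refine c' (s, y) ⟨⟨h, hy⟩, mem_iInter.2 fun i => ?_⟩
        rcases hz i with hh | hh
        · exact (hd hh.2.1 h).elim
        · exact hh.1
    · have hsub : (((O ∪ O') ×ˢ C) \ ⋃ i, (U i ∩ (O ×ˢ Set.univ)) ∪ (V i ∩ (O' ×ˢ Set.univ))) ⊆
          ((O ×ˢ C) \ ⋃ i, U i) ∪ ((O' ×ˢ C) \ ⋃ i, V i) := by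
        rintro ⟨s, y⟩ ⟨⟨h | h, hy⟩, hz⟩
        · refine Or.inl ⟨⟨h, hy⟩, fun hh => hz ?_⟩
          obtain ⟨i, hi⟩ := mem_iUnion.1 hh
          exact mem_iUnion.2 ⟨i, Or.inl ⟨hi, h, trivial⟩⟩
        · refine Or.inr ⟨⟨h, hy⟩, fun hh => hz ?_⟩
          obtain ⟨i, hi⟩ := mem_iUnion.1 hh
          exact mem_iUnion.2 ⟨i, Or.inr ⟨hi, h, trivial⟩⟩
      refine rlt_mono hsub (rlt_union ?_ ?_ ?_ d d')
      · exact (hO.isClosed.prod hC).sdiff (isOpen_iUnion a)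
      · exact (hO'.isClosed.prod hC).sdiff (isOpen_iUnion a')
      · rw [Set.disjoint_left]
        rintro ⟨s, y⟩ hz hz'
        exact hd hz.1.1 hz'.1.1
  have main : ∃ O : Set S, IsClopen O ∧ Set.univ ⊆ O ∧ Good O := by
    refine isCompact_univ.induction_on (p := fun A => ∃ O : Set S, IsClopen O ∧ A ⊆ O ∧ Good O)
      ?_ ?_ ?_ ?_
    · refine ⟨∅, isClopen_empty, subset_rfl, fun _ => ∅, fun _ => isOpen_empty, by simp, by simp,
        Or.inl (by simp)⟩
    · rintro s t hst ⟨O, h1, h2, h3⟩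
      exact ⟨O, h1, hst.trans h2, h3⟩
    · rintro s t ⟨O, h1, h2, h3⟩ ⟨O', h1', h2', h3'⟩
      refine ⟨O ∪ (O' \ O), h1.union (h1'.diff h1), ?_, ?_⟩
      · rw [union_sdiff_self]
        exact union_subset_union h2 h2'
      · exact good_union _ _ h1 (h1'.diff h1) disjoint_sdiff_right h3
          (good_mono _ _ sdiff_subset h3')
    · intro s _
      obtain ⟨U, a, b, c, d⟩ := h (fun i => {y | (s, y) ∈ G i})
        (fun i => (hG i).preimage (by fun_prop : Continuous fun y : Y => (s, y)))
        (fun i y hy => (hGC i hy).2) (by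
          rw [Set.eq_empty_iff_forall_notMem] at hG0 ⊢
          intro y hy
          exact hG0 (s, y) (by simpa using hy))
      have hcl : ∀ i, IsClosed (Prod.fst '' (G i \ (Set.univ ×ˢ U i)) : Set S) := fun i =>
        isClosedMap_fst_of_compactSpace _ ((hG i).sdiff (isOpen_univ.prod (a i)))
      obtain ⟨O, hO, hsO, hOs⟩ := compact_exists_isClopen_in_isOpen
        (x := s) (U := ⋂ i, (Prod.fst '' (G i \ (Set.univ ×ˢ U i)) : Set S)ᶜ)
        (isOpen_iInter_of_finite fun i => (hcl i).isOpen_compl) (by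
          rw [mem_iInter]
          rintro i ⟨⟨s', y⟩, ⟨h1, h2⟩, rfl⟩
          exact h2 ⟨trivial, b i h1⟩)
      refine ⟨O, mem_nhdsWithin_of_mem_nhds (hO.isOpen.mem_nhds hsO), O, hO, subset_rfl,
        fun i => Set.univ ×ˢ U i, fun i => isOpen_univ.prod (a i), ?_, ?_, ?_⟩
      · rintro i ⟨s', y⟩ ⟨h1, h2⟩
        by_contra h3
        exact (mem_iInter.1 (hOs h2.1) i) ⟨(s', y), ⟨h1, h3⟩, rfl⟩
      · rw [Set.eq_empty_iff_forall_notMem] at c ⊢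
        rintro ⟨s', y⟩ ⟨h1, h2⟩
        exact c y ⟨h1.2, by simpa using h2⟩
      · have hs : ((O ×ˢ C) \ ⋃ i, (Set.univ : Set S) ×ˢ U i) ⊆ Set.univ ×ˢ (C \ ⋃ i, U i) := by
          rintro ⟨s', y⟩ ⟨h1, h2⟩
          exact ⟨trivial, h1.2, by simpa using h2⟩
        refine rlt_mono hs ?_
        rcases d with d | ⟨β, hβ, d⟩
        · left; rw [d, prod_empty]
        · exact Or.inr ⟨β, hβ, ih β hβ (hC.sdiff (isOpen_iUnion a)) d⟩
  obtain ⟨O, -, hO, U, a, b, c, d⟩ := main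
  obtain rfl : O = Set.univ := univ_subset_iff.1 hO
  exact ⟨U, a, fun i => (by simpa using b i), c, d⟩

end S17

namespace S17

/-- An abstract description of the space `Z(X,Y)`. -/
structure ZData (X Y ι Z : Type) [TopologicalSpace X] [TopologicalSpace Y] [TopologicalSpace ι]
    [TopologicalSpace Z] (φ : ι → Set X) where
  p : Z → OnePoint ι
  q : Z → X
  h : X → Z
  g : ∀ a : ι, (φ a) × Y → Z
  hp : Continuous p
  hq : Continuous q
  hh : Continuous h
  hg : ∀ a, Continuous (g a)
  qh : ∀ x, q (h x) = x
  ph : ∀ x, p (h x) = OnePoint.infty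
  hinf : ∀ z, p z = OnePoint.infty → h (q z) = z
  ginj : ∀ a, Function.Injective (g a)
  pg : ∀ (a : ι) t, p (g a t) = (a : OnePoint ι)
  qg : ∀ (a : ι) t, q (g a t) = t.1
  gsurj : ∀ (a : ι) z, p z = (a : OnePoint ι) → ∃ t, g a t = z

lemma fin_of_closed {ι Z : Type} [TopologicalSpace ι] [DiscreteTopology ι] [TopologicalSpace Z]
    [CompactSpace Z] {p : Z → OnePoint ι} (hp : Continuous p) {D : Set Z} (hD : IsClosed D)
    (h : ∀ z ∈ D, p z ≠ OnePoint.infty) : {a : ι | ∃ z ∈ D, p z = (a : OnePoint ι)}.Finite := by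
  have h1 : IsCompact (p '' D) := hD.isCompact.image hp
  have h2 : IsOpen (p '' D)ᶜ := h1.isClosed.isOpen_compl
  have h3 : (OnePoint.infty : OnePoint ι) ∈ (p '' D)ᶜ := by
    rintro ⟨z, hz, hz'⟩
    exact h z hz hz'
  have h4 := ((OnePoint.isOpen_iff_of_mem h3).1 h2).2
  have h5 := h4.finite_of_discrete
  refine h5.subset ?_
  rintro a ⟨z, hz, hza⟩
  simp only [mem_compl_iff, mem_preimage, not_not]
  exact ⟨z, hz, hza⟩

lemma open_fiber {ι Z : Type} [TopologicalSpace ι] [DiscreteTopology ι] [TopologicalSpace Z]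
    {p : Z → OnePoint ι} (hp : Continuous p) (a : ι) : IsOpen (p ⁻¹' {(a : OnePoint ι)}) := by
  refine IsOpen.preimage hp ?_
  have := (OnePoint.isOpenEmbedding_coe (X := ι)).isOpenMap {a} (isOpen_discrete _)
  simpa using this

lemma closed_fiber {ι Z : Type} [TopologicalSpace ι] [DiscreteTopology ι] [TopologicalSpace Z]
    {p : Z → OnePoint ι} (hp : Continuous p) (a : ι) : IsClosed (p ⁻¹' {(a : OnePoint ι)}) :=
  isClosed_singleton.preimage hp

/-- Gluing of open tuples. -/
lemma glue {k : ℕ} {ι Z : Type} [TopologicalSpace ι] [DiscreteTopology ι] [TopologicalSpace Z]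
    {p : Z → OnePoint ι} (hp : Continuous p) (B : Set Z) (G W : Fin (k + 1) → Set Z)
    (Q : ι → Fin (k + 1) → Set Z) (E : Set ι) (hE : E.Finite)
    (hW : ∀ i, IsOpen (W i)) (hQ : ∀ a i, IsOpen (Q a i))
    (h1 : ∀ a ∉ E, ∀ i, ∀ z ∈ B, p z = (a : OnePoint ι) → z ∈ W i → z ∈ Q a i)
    (h2 : ∀ (a : ι) i, ∀ z ∈ G i, p z = (a : OnePoint ι) → z ∈ Q a i)
    (h3 : ∀ i, ∀ z ∈ G i, p z = OnePoint.infty → z ∈ W i)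
    (h4 : ∀ z ∈ B, p z = OnePoint.infty → ¬ ∀ i, z ∈ W i)
    (h5 : ∀ a : ι, ∀ z ∈ B, p z = (a : OnePoint ι) → ¬ ∀ i, z ∈ Q a i) :
    ∃ U : Fin (k + 1) → Set Z, (∀ i, IsOpen (U i)) ∧ (∀ i, G i ⊆ U i) ∧ (B ∩ ⋂ i, U i) = ∅ ∧
      (∀ z, p z = OnePoint.infty → ∀ i, (z ∈ U i ↔ z ∈ W i)) ∧
      (∀ a : ι, ∀ z ∈ B, p z = (a : OnePoint ι) → ∀ i, (z ∈ U i ↔ z ∈ Q a i)) := by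
  have hEc : IsClosed ((fun a : ι => (a : OnePoint ι)) '' E) := (hE.image _).isClosed
  have key1 : ∀ z, p z = OnePoint.infty → ∀ i,
      (z ∈ (W i ∩ p ⁻¹' ((fun a : ι => (a : OnePoint ι)) '' E)ᶜ) ∪
        ⋃ a : ι, (p ⁻¹' {(a : OnePoint ι)} ∩ Q a i) ↔ z ∈ W i) := by
    intro z hz i
    constructor
    · rintro (h | h)
      · exact h.1
      · obtain ⟨a, ha, -⟩ := mem_iUnion.1 h
        rw [mem_preimage, hz] at ha
        exact (OnePoint.infty_ne_coe a (mem_singleton_iff.1 ha)).elim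
    · intro h
      refine Or.inl ⟨h, ?_⟩
      rintro ⟨a, -, ha⟩
      rw [hz] at ha
      exact OnePoint.coe_ne_infty a ha
  have key2 : ∀ a : ι, ∀ z ∈ B, p z = (a : OnePoint ι) → ∀ i,
      (z ∈ (W i ∩ p ⁻¹' ((fun a : ι => (a : OnePoint ι)) '' E)ᶜ) ∪
        ⋃ a : ι, (p ⁻¹' {(a : OnePoint ι)} ∩ Q a i) ↔ z ∈ Q a i) := by
    intro a z hB hz i
    constructor
    · rintro (h | h)
      · refine h1 a ?_ i z hB hz h.1
        intro ha
        exact h.2 ⟨a, ha, hz.symm⟩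
      · obtain ⟨b, hb, h⟩ := mem_iUnion.1 h
        rw [mem_preimage, hz, mem_singleton_iff, OnePoint.coe_eq_coe] at hb
        rwa [hb]
    · intro h
      exact Or.inr (mem_iUnion.2 ⟨a, hz, h⟩)
  refine ⟨fun i => (W i ∩ p ⁻¹' ((fun a : ι => (a : OnePoint ι)) '' E)ᶜ) ∪
    ⋃ a : ι, (p ⁻¹' {(a : OnePoint ι)} ∩ Q a i), ?_, ?_, ?_, key1, key2⟩
  · intro i
    exact ((hW i).inter (hEc.isOpen_compl.preimage hp)).union
      (isOpen_iUnion fun a : ι => (open_fiber hp a).inter (hQ a i))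
  · intro i z hz
    rcases hpz : p z with _ | a
    · exact (key1 z hpz i).2 (h3 i z hz hpz)
    · exact Or.inr (mem_iUnion.2 ⟨a, hpz, h2 a i z hz hpz⟩)
  · rw [Set.eq_empty_iff_forall_notMem]
    rintro z ⟨hB, hz⟩
    rw [mem_iInter] at hz
    rcases hpz : p z with _ | a
    · exact h4 z hB hpz fun i => (key1 z hpz i).1 (hz i)
    · exact h5 a z hB hpz fun i => (key2 a z hB hpz i).1 (hz i)

lemma exists_ne_fin {k : ℕ} (hk : 1 ≤ k) : (Fin.last k) ≠ (0 : Fin (k + 1)) := by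
  intro h
  have := congrArg Fin.val h
  simp at this
  omega

set_option linter.unusedSectionVars false

section
variable {X Y ι Z : Type} [TopologicalSpace X] [TopologicalSpace Y] [TopologicalSpace ι]
    [TopologicalSpace Z] {φ : ι → Set X} [CompactSpace X] [T2Space X]
    [CompactSpace Y] [T2Space Y]
    [DiscreteTopology ι] [CompactSpace Z] [T2Space Z]

lemma ZData.hemb (d : ZData X Y ι Z φ) : IsClosedEmbedding d.h :=
  d.hh.isClosedEmbedding (Function.LeftInverse.injective d.qh)

/-- exceptional indices -/
lemma ZData.exc {k : ℕ} (d : ZData X Y ι Z φ) (G : Fin (k + 1) → Set Z) (hG : ∀ i, IsClosed (G i))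
    (W : Fin (k + 1) → Set X) (hW : ∀ i, IsOpen (W i)) (hGW : ∀ i, d.h ⁻¹' G i ⊆ W i) :
    {a : ι | ∃ i, ∃ z ∈ G i \ d.q ⁻¹' W i, d.p z = (a : OnePoint ι)}.Finite := by
  have : {a : ι | ∃ i, ∃ z ∈ G i \ d.q ⁻¹' W i, d.p z = (a : OnePoint ι)} =
      ⋃ i, {a : ι | ∃ z ∈ G i \ d.q ⁻¹' W i, d.p z = (a : OnePoint ι)} := by
    ext; simp
  rw [this]
  refine finite_iUnion fun i => fin_of_closed d.hp ((hG i).sdiff ((hW i).preimage d.hq)) ?_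
  rintro z ⟨h1, h2⟩ hz
  refine h2 (hGW i ?_)
  rw [mem_preimage, d.hinf z hz]
  exact h1

/-- The second step of the upper bound. -/
lemma ZData.step2 {k : ℕ} (hk : 1 ≤ k) (d : ZData X Y ι Z φ) {α : Ordinal.{0}} {B : Set Z}
    (hB : IsClosed B) (hB1 : RLT k α (d.h ⁻¹' B))
    (hB2 : ∀ a : ι, RLE k α (B ∩ d.p ⁻¹' {(a : OnePoint ι)}))
    (E₀ : Set ι) (hE₀ : E₀.Finite)
    (hB3 : ∀ a ∉ E₀, ∀ z ∈ B, ∀ z' ∈ B, d.p z = (a : OnePoint ι) → d.p z' = (a : OnePoint ι) →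
      d.q z = d.q z')
    (hB4 : ∀ a ∉ E₀, ∀ z ∈ B, d.p z = (a : OnePoint ι) → d.h (d.q z) ∈ B) :
    RLE k α B := by
  rw [rle_iff]
  intro G hG hGB hG0
  have hW : ∃ W : Fin (k + 1) → Set X, (∀ i, IsOpen (W i)) ∧ (∀ i, d.h ⁻¹' G i ⊆ W i) ∧
      (d.h ⁻¹' B ∩ ⋂ i, W i) = ∅ ∧ RLT k α (d.h ⁻¹' B \ ⋃ i, W i) := by
    rcases hB1 with h | ⟨β, hβ, h⟩
    · refine ⟨fun _ => ∅, fun _ => isOpen_empty, ?_, by simp [h], Or.inl (by simp [h])⟩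
      intro i
      rw [← h]
      exact preimage_mono (hGB i)
    · obtain ⟨W, a, b, c, e⟩ := rle_iff.1 h (fun i => d.h ⁻¹' G i)
        (fun i => (hG i).preimage d.hh) (fun i => preimage_mono (hGB i))
        (by rw [← preimage_iInter, hG0, preimage_empty])
      exact ⟨W, a, b, c, rlt_mono_ord hβ.le e⟩
  obtain ⟨W, hWo, hGW, hW0, hWd⟩ := hW
  have hQ' : ∀ a : ι, ∃ Q : Fin (k + 1) → Set Z, (∀ i, IsOpen (Q i)) ∧
      (∀ i, G i ∩ d.p ⁻¹' {(a : OnePoint ι)} ⊆ Q i) ∧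
      ((B ∩ d.p ⁻¹' {(a : OnePoint ι)}) ∩ ⋂ i, Q i) = ∅ ∧
      RLT k α ((B ∩ d.p ⁻¹' {(a : OnePoint ι)}) \ ⋃ i, Q i) := fun a =>
    rle_iff.1 (hB2 a) (fun i => G i ∩ d.p ⁻¹' {(a : OnePoint ι)})
      (fun i => (hG i).inter (closed_fiber d.hp a)) (fun i => inter_subset_inter_left _ (hGB i))
      (subset_empty_iff.1 (hG0 ▸ iInter_mono fun i => inter_subset_left))
  choose Q' hQo hQG hQ0 hQd using hQ'
  set E : Set ι := E₀ ∪ {a : ι | ∃ i, ∃ z ∈ G i \ d.q ⁻¹' W i, d.p z = (a : OnePoint ι)} with hEdef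
  have hE : E.Finite := hE₀.union (d.exc G hG W hWo hGW)
  let Q : ι → Fin (k + 1) → Set Z := fun a i =>
    if a ∈ E then Q' a i else
      if (∃ z ∈ B, d.p z = (a : OnePoint ι) ∧ ∃ j, d.q z ∈ W j) ∨ i ≠ 0 then d.q ⁻¹' W i
      else Set.univ
  obtain ⟨U, hUo, hGU, hU0, hUinf, hUa⟩ := glue d.hp B G (fun i => d.q ⁻¹' W i) Q E hE
    (fun i => (hWo i).preimage d.hq) (by
      intro a i
      simp only [Q]
      split_ifs
      · exact hQo a i
      · exact (hWo i).preimage d.hq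
      · exact isOpen_univ) (by
      intro a ha i z hz hp hzW
      simp only [Q, if_neg ha]
      split_ifs
      · exact hzW
      · trivial) (by
      intro a i z hz hp
      by_cases ha : a ∈ E
      · simp only [Q, if_pos ha]
        exact hQG a i ⟨hz, hp⟩
      · have : d.q z ∈ W i := by
          by_contra hc
          exact ha (Or.inr ⟨i, z, ⟨hz, hc⟩, hp⟩)
        simp only [Q, if_neg ha]
        split_ifs
        · exact this
        · trivial) (by
      intro i z hz hp
      refine hGW i ?_
      rw [mem_preimage, d.hinf z hp]
      exact hz) (by
      intro z hz hp hall
      rw [Set.eq_empty_iff_forall_notMem] at hW0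
      refine hW0 (d.q z) ⟨?_, mem_iInter.2 hall⟩
      rw [mem_preimage, d.hinf z hp]
      exact hz) (by
      intro a z hz hp hall
      by_cases ha : a ∈ E
      · simp only [Q, if_pos ha] at hall
        exact (Set.eq_empty_iff_forall_notMem.1 (hQ0 a)) z ⟨⟨hz, hp⟩, mem_iInter.2 hall⟩
      · simp only [Q, if_neg ha] at hall
        by_cases hc : ∃ z ∈ B, d.p z = (a : OnePoint ι) ∧ ∃ j, d.q z ∈ W j
        · simp only [hc, true_or, if_true] at hall
          refine (Set.eq_empty_iff_forall_notMem.1 hW0) (d.q z) ⟨?_, mem_iInter.2 hall⟩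
          exact hB4 a (fun h => ha (Or.inl h)) z hz hp
        · have := hall (Fin.last k)
          simp only [exists_ne_fin hk, ne_eq, not_false_eq_true, or_true, if_true] at this
          exact hc ⟨z, hz, hp, _, this⟩)
  refine ⟨U, hUo, hGU, hU0, ?_⟩
  have hsub : B \ ⋃ i, U i ⊆ (d.h '' (d.h ⁻¹' B \ ⋃ i, W i)) ∪
      ⋃ a ∈ E, ((B ∩ d.p ⁻¹' {(a : OnePoint ι)}) \ ⋃ i, Q' a i) := by
    rintro z ⟨hz, hzU⟩
    rw [mem_iUnion, not_exists] at hzU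
    rcases hpz : d.p z with _ | a
    · left
      refine ⟨d.q z, ⟨?_, ?_⟩, d.hinf z hpz⟩
      · rw [mem_preimage, d.hinf z hpz]
        exact hz
      · rw [mem_iUnion, not_exists]
        exact fun i hi => hzU i ((hUinf z hpz i).2 hi)
    · right
      have hzQ : ∀ i, z ∉ Q a i := fun i hi => hzU i ((hUa a z hz hpz i).2 hi)
      by_cases ha : a ∈ E
      · simp only [Q, if_pos ha] at hzQ
        exact mem_iUnion₂.2 ⟨a, ha, ⟨hz, hpz⟩, by simpa using hzQ⟩
      · exfalso
        simp only [Q, if_neg ha] at hzQ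
        by_cases hc : ∃ z ∈ B, d.p z = (a : OnePoint ι) ∧ ∃ j, d.q z ∈ W j
        · simp only [hc, true_or, if_true] at hzQ
          obtain ⟨z', hz', hp', j, hj⟩ := hc
          refine hzQ j ?_
          rw [mem_preimage, hB3 a (fun h => ha (Or.inl h)) z hz z' hz' hpz hp']
          exact hj
        · have := hzQ 0
          simp only [hc, ne_eq, not_true_eq_false, or_self, if_false] at this
          exact this trivial
  have hcX : IsClosed (d.h ⁻¹' B \ ⋃ i, W i) := (hB.preimage d.hh).sdiff (isOpen_iUnion hWo)
  have hcA : ∀ a : ι, IsClosed ((B ∩ d.p ⁻¹' {(a : OnePoint ι)}) \ ⋃ i, Q' a i) := fun a =>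
    (hB.inter (closed_fiber d.hp a)).sdiff (isOpen_iUnion (hQo a))
  refine rlt_mono hsub (rlt_union (d.hemb.isClosedMap _ hcX)
    (hE.isClosed_biUnion fun a _ => hcA a) ?_ ((rlt_image_iff d.h d.hemb hcX).2 hWd)
    (rlt_biUnion hE _ (fun a _ => hcA a) ?_ fun a _ => hQd a))
  · rw [Set.disjoint_left]
    rintro _ ⟨x, -, rfl⟩ hx
    obtain ⟨a, -, ⟨-, hx⟩, -⟩ := mem_iUnion₂.1 hx
    rw [mem_preimage, d.ph] at hx
    exact OnePoint.infty_ne_coe a hx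
  · intro a b hab
    rw [Set.disjoint_left]
    rintro z ⟨⟨-, h1⟩, -⟩ ⟨⟨-, h2⟩, -⟩
    rw [mem_preimage, mem_singleton_iff] at h1 h2
    rw [h1, OnePoint.coe_eq_coe] at h2
    exact hab h2

lemma sfam_tuple {k : ℕ} (hk : 1 ≤ k) {S : Set X} (hS : S ∈ SFam X)
    (W : Fin (k + 1) → Set X) (hW : ∀ i, IsOpen (W i)) (hW0 : (⋂ i, W i) = ∅) :
    ∃ V : Fin (k + 1) → Set X, (∀ i, IsOpen (V i)) ∧ (∀ i, W i ⊆ V i) ∧ (S ∩ ⋂ i, V i) = ∅ ∧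
      (S \ ⋃ i, V i).Subsingleton := by
  have key : ∃ O : Set X, IsOpen O ∧ (S ∩ O ⊆ (⋃ i, W i)ᶜ) ∧
      ((S \ ⋃ i, W i) \ O).Subsingleton := by
    rcases hS with hS | ⟨⟨e⟩⟩
    · refine ⟨(S ∩ ⋃ i, W i)ᶜ, (hS.subset inter_subset_left).isClosed.isOpen_compl, ?_, ?_⟩
      · rintro x ⟨h1, h2⟩ h3
        exact h2 ⟨h1, h3⟩
      · rintro x ⟨⟨h1, h2⟩, h3⟩
        exact (h3 fun h => h2 h.2).elim
    · let D : Set S := {s | (s : X) ∉ ⋃ i, W i ∧ e s ≠ OnePoint.infty}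
      have hD : IsOpen D := by
        rw [← e.isOpen_image, OnePoint.isOpen_iff_of_notMem]
        · exact isOpen_discrete _
        · rintro ⟨s, hs, hs'⟩
          exact hs.2 hs'
      obtain ⟨O, hO, hOD⟩ := isOpen_induced_iff.1 hD
      refine ⟨O, hO, ?_, ?_⟩
      · rintro x ⟨h1, h2⟩
        have : (⟨x, h1⟩ : S) ∈ D := by rw [← hOD]; exact h2
        exact this.1
      · have hx : ∀ x, ∀ h : x ∈ (S \ ⋃ i, W i) \ O, e ⟨x, h.1.1⟩ = OnePoint.infty := by
          intro x h
          by_contra hc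
          have : (⟨x, h.1.1⟩ : S) ∈ D := ⟨h.1.2, hc⟩
          rw [← hOD] at this
          exact h.2 this
        intro x h y h'
        have := e.injective ((hx x h).trans (hx y h').symm)
        exact congrArg Subtype.val this
  obtain ⟨O, hO, hO1, hO2⟩ := key
  refine ⟨fun i => if i = 0 then W i ∪ O else W i, ?_, ?_, ?_, ?_⟩
  · intro i
    dsimp only
    split_ifs
    · exact (hW i).union hO
    · exact hW i
  · intro i
    dsimp only
    split_ifs
    · exact subset_union_left
    · exact subset_rfl
  · rw [Set.eq_empty_iff_forall_notMem] at hW0 ⊢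
    rintro x ⟨hxS, hx⟩
    rw [mem_iInter] at hx
    by_cases hxO : x ∈ O
    · have h1 := hx (Fin.last k)
      rw [if_neg (exists_ne_fin hk)] at h1
      exact hO1 ⟨hxS, hxO⟩ (mem_iUnion.2 ⟨_, h1⟩)
    · refine hW0 x (mem_iInter.2 fun i => ?_)
      have := hx i
      split_ifs at this
      · exact this.resolve_right hxO
      · exact this
  · refine hO2.anti ?_
    rintro x ⟨h1, h2⟩
    rw [mem_iUnion, not_exists] at h2
    refine ⟨⟨h1, ?_⟩, ?_⟩
    · rw [mem_iUnion, not_exists]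
      intro i hi
      refine h2 i ?_
      split_ifs
      · exact Or.inl hi
      · exact hi
    · intro h
      refine h2 0 ?_
      rw [if_pos rfl]
      exact Or.inr h

lemma sfam_compact {S : Set X} (hS : S ∈ SFam X) : IsCompact S := by
  rcases hS with hS | ⟨⟨e⟩⟩
  · exact hS.isCompact
  · rw [isCompact_iff_compactSpace]
    exact e.symm.compactSpace

lemma sfam_td {S : Set X} (hS : S ∈ SFam X) : TotallyDisconnectedSpace S := by
  rcases hS with hS | ⟨⟨e⟩⟩
  · have : Finite S := hS
    infer_instance
  · exact e.symm.totallyDisconnectedSpace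

lemma ZData.upper {k : ℕ} (hk : 1 ≤ k) (d : ZData X Y ι Z φ) (hφ : ∀ a, φ a ∈ SFam X)
    {α : Ordinal.{0}} (hX : KIndLE (bComplex k) X α) (hY : KIndLE (bComplex k) Y α) :
    KIndLE (bComplex k) Z (α + 1) := by
  have hX' : RLE k α (Set.univ : Set X) := by
    have := (kindle_iff_rle (k := k) (α := α) (id : X → X) IsClosedEmbedding.id).1 hX
    rwa [range_id] at this
  have hY' : RLE k α (Set.univ : Set Y) := by
    have := (kindle_iff_rle (k := k) (α := α) (id : Y → Y) IsClosedEmbedding.id).1 hY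
    rwa [range_id] at this
  have hH : ∀ a : ι, RLE k α (d.p ⁻¹' {(a : OnePoint ι)}) := by
    intro a
    have := isCompact_iff_compactSpace.1 (sfam_compact (hφ a))
    have := sfam_td (hφ a)
    have h1 : RLE k α ((Set.univ : Set (φ a)) ×ˢ (Set.univ : Set Y)) := rle_prod isClosed_univ hY'
    have h2 := (rle_image_iff (d.g a) ((d.hg a).isClosedEmbedding (d.ginj a))
      (isClosed_univ.prod isClosed_univ)).2 h1
    refine rle_mono ?_ h2
    intro z hz
    obtain ⟨t, rfl⟩ := d.gsurj a z hz
    exact ⟨t, ⟨trivial, trivial⟩, rfl⟩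
  have hgoal : RLE k (α + 1) (Set.univ : Set Z) := by
    rw [rle_iff]
    intro G hG _ hG0
    obtain ⟨W, hWo, hGW, hW0, hWd⟩ := rle_iff.1 hX' (fun i => d.h ⁻¹' G i)
      (fun i => (hG i).preimage d.hh) (fun i => subset_univ _)
      (by rw [← preimage_iInter, hG0, preimage_empty])
    rw [univ_inter] at hW0
    have hQ' : ∀ a : ι, ∃ Q : Fin (k + 1) → Set Z, (∀ i, IsOpen (Q i)) ∧
        (∀ i, G i ∩ d.p ⁻¹' {(a : OnePoint ι)} ⊆ Q i) ∧
        (d.p ⁻¹' {(a : OnePoint ι)} ∩ ⋂ i, Q i) = ∅ ∧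
        RLT k α (d.p ⁻¹' {(a : OnePoint ι)} \ ⋃ i, Q i) := fun a =>
      rle_iff.1 (hH a) (fun i => G i ∩ d.p ⁻¹' {(a : OnePoint ι)})
        (fun i => (hG i).inter (closed_fiber d.hp a)) (fun i => inter_subset_right)
        (subset_empty_iff.1 (hG0 ▸ iInter_mono fun i => inter_subset_left))
    choose Q' hQo hQG hQ0 hQd using hQ'
    have hV := fun a => sfam_tuple hk (hφ a) W hWo hW0
    choose V hVo hWV hV0 hVs using hV
    set E : Set ι := {a : ι | ∃ i, ∃ z ∈ G i \ d.q ⁻¹' W i, d.p z = (a : OnePoint ι)} with hEdef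
    have hE : E.Finite := d.exc G hG W hWo hGW
    have hqφ : ∀ (a : ι) z, d.p z = (a : OnePoint ι) → d.q z ∈ φ a := by
      intro a z hz
      obtain ⟨t, rfl⟩ := d.gsurj a z hz
      rw [d.qg]
      exact t.1.2
    let Q : ι → Fin (k + 1) → Set Z := fun a i => if a ∈ E then Q' a i else d.q ⁻¹' V a i
    obtain ⟨U, hUo, hGU, hU0, hUinf, hUa⟩ := glue d.hp Set.univ G (fun i => d.q ⁻¹' W i) Q E hE
      (fun i => (hWo i).preimage d.hq) (by
        intro a i
        simp only [Q]
        split_ifs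
        · exact hQo a i
        · exact (hVo a i).preimage d.hq) (by
        intro a ha i z hz hp hzW
        simp only [Q, if_neg ha]
        exact hWV a i hzW) (by
        intro a i z hz hp
        by_cases ha : a ∈ E
        · simp only [Q, if_pos ha]
          exact hQG a i ⟨hz, hp⟩
        · simp only [Q, if_neg ha]
          refine hWV a i ?_
          by_contra hc
          exact ha ⟨i, z, ⟨hz, hc⟩, hp⟩) (by
        intro i z hz hp
        refine hGW i ?_
        rw [mem_preimage, d.hinf z hp]
        exact hz) (by
        intro z hz hp hall
        exact (Set.eq_empty_iff_forall_notMem.1 hW0) (d.q z) (mem_iInter.2 hall)) (by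
        intro a z hz hp hall
        by_cases ha : a ∈ E
        · simp only [Q, if_pos ha] at hall
          exact (Set.eq_empty_iff_forall_notMem.1 (hQ0 a)) z ⟨hp, mem_iInter.2 hall⟩
        · simp only [Q, if_neg ha] at hall
          exact (Set.eq_empty_iff_forall_notMem.1 (hV0 a)) (d.q z)
            ⟨hqφ a z hp, mem_iInter.2 hall⟩)
    refine ⟨U, hUo, hGU, hU0, Or.inr ⟨α, lt_add_one α, ?_⟩⟩
    have hout : ∀ a ∉ E, ∀ z ∈ Set.univ \ ⋃ i, U i, d.p z = (a : OnePoint ι) →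
        d.q z ∈ φ a \ ⋃ i, V a i := by
      rintro a ha z ⟨-, hz⟩ hp
      refine ⟨hqφ a z hp, ?_⟩
      rw [mem_iUnion, not_exists] at hz ⊢
      intro i hi
      refine hz i ((hUa a z trivial hp i).2 ?_)
      simp only [Q, if_neg ha]
      exact hi
    refine d.step2 hk (isClosed_univ.sdiff (isOpen_iUnion hUo)) ?_ ?_ E hE ?_ ?_
    · refine rlt_mono ?_ hWd
      rintro x ⟨-, hx⟩
      refine ⟨trivial, ?_⟩
      rw [mem_iUnion, not_exists] at hx ⊢
      intro i hi
      refine hx i ((hUinf _ (d.ph x) i).2 ?_)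
      rw [mem_preimage, d.qh]
      exact hi
    · intro a
      exact rle_mono inter_subset_right (hH a)
    · intro a ha z hz z' hz' hp hp'
      exact hVs a (hout a ha z hz hp) (hout a ha z' hz' hp')
    · intro a ha z hz hp
      refine ⟨trivial, ?_⟩
      have h1 := (hout a ha z hz hp).2
      rw [mem_iUnion, not_exists] at h1 ⊢
      intro i hi
      have := (hUinf _ (d.ph _) i).1 hi
      rw [mem_preimage, d.qh] at this
      exact h1 i (hWV a i this)
  have := (kindle_iff_rle (k := k) (α := α + 1) (id : Z → Z) IsClosedEmbedding.id).2
  rw [range_id] at this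
  exact this hgoal

end

end S17

namespace S17

lemma ofOrdinal_inj {a b : Ordinal.{0}} (h : Dim.ofOrdinal a = Dim.ofOrdinal b) : a = b := by
  unfold Dim.ofOrdinal at h
  exact WithBot.coe_injective (WithTop.coe_injective h)

lemma kind_eq {k : ℕ} {X : Type} [TopologicalSpace X] {α : Ordinal.{0}}
    (h : KInd (bComplex k) X = Dim.ofOrdinal α) :
    KIndLE (bComplex k) X α ∧ ∀ β < α, ¬ KIndLE (bComplex k) X β := by
  unfold KInd at h
  split_ifs at h with h1 h2
  · exfalso
    unfold Dim.minusOne Dim.ofOrdinal at h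
    exact WithBot.bot_ne_coe (WithTop.coe_injective h)
  · have := ofOrdinal_inj h
    subst this
    exact ⟨csInf_mem h2, fun β hβ hh => (notMem_of_lt_csInf' hβ) hh⟩
  · exfalso
    unfold Dim.ofOrdinal at h
    exact WithTop.top_ne_coe h

lemma kind_eq_of {k : ℕ} {X : Type} [TopologicalSpace X] [Nonempty X] {α : Ordinal.{0}}
    (h : KIndLE (bComplex k) X α) (h' : ∀ β < α, ¬ KIndLE (bComplex k) X β) :
    KInd (bComplex k) X = Dim.ofOrdinal α := by
  unfold KInd
  rw [if_neg (not_isEmpty_of_nonempty X), if_pos ⟨α, h⟩]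
  congr 1
  refine le_antisymm (csInf_le' h) ?_
  by_contra hc
  exact h' _ (not_le.1 hc) (csInf_mem (s := {α | KIndLE (bComplex k) X α}) ⟨α, h⟩)

lemma kind_lt {k : ℕ} {X : Type} [TopologicalSpace X] {α β : Ordinal.{0}} (hβ : β < α)
    (h : KIndLE (bComplex k) X β) : KInd (bComplex k) X < Dim.ofOrdinal α := by
  unfold KInd
  split_ifs with h1 h2
  · unfold Dim.minusOne Dim.ofOrdinal
    exact WithTop.coe_lt_coe.2 (WithBot.bot_lt_coe α)
  · unfold Dim.ofOrdinal
    exact WithTop.coe_lt_coe.2 (WithBot.coe_lt_coe.2 ((csInf_le' (s := {α | KIndLE (bComplex k) X α}) h).trans_lt hβ))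
  · exact (h2 ⟨β, h⟩).elim

lemma kind_lt_of_rlt {k : ℕ} {X : Type} [TopologicalSpace X] {α : Ordinal.{0}}
    {A : Set X} (hA : IsClosed A) (h : RLT k α A) :
    KInd (bComplex k) A < Dim.ofOrdinal α := by
  rcases h with rfl | ⟨β, hβ, h⟩
  · unfold KInd
    rw [if_pos (by infer_instance)]
    unfold Dim.minusOne Dim.ofOrdinal
    exact WithTop.coe_lt_coe.2 (WithBot.bot_lt_coe α)
  · refine kind_lt hβ ((kindle_iff_rle ((↑) : A → X) hA.isClosedEmbedding_subtypeVal).2 ?_)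
    rwa [Subtype.range_val]

lemma sfam_of_seq {X : Type} [TopologicalSpace X] [T2Space X] {T : Set X} {x : X}
    (hc : T.Countable) (hi : T.Infinite) (hx : x ∉ T) (hN : ∀ N ∈ 𝓝 x, (T \ N).Finite) :
    insert x T ∈ SFam X := by
  right
  have : Infinite T := hi.to_subtype
  have : Countable T := hc.to_subtype
  obtain ⟨f⟩ : Nonempty (ℕ ≃ T) := by
    obtain ⟨e⟩ := nonempty_denumerable T
    exact ⟨(Denumerable.eqv T).symm⟩
  have hf : Filter.Tendsto (fun n => (f n : X)) Filter.atTop (𝓝 x) := by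
    rw [← Nat.cofinite_eq_atTop]
    intro N hNx
    rw [Filter.mem_map, Filter.mem_cofinite]
    have := (hN N hNx).preimage (f := fun n => (f n : X))
      ((Subtype.val_injective.comp f.injective).injOn)
    refine this.subset ?_
    intro n hn
    exact ⟨(f n).2, hn⟩
  have hrange : range (fun n => (f n : X)) = T := by
    ext t; constructor
    · rintro ⟨n, rfl⟩
      exact (f n).2
    · intro ht
      exact ⟨f.symm ⟨t, ht⟩, by simp⟩
  have hcomp : IsCompact (insert x T) := by
    have := hf.isCompact_insert_range
    rwa [hrange] at this
  have := isCompact_iff_compactSpace.1 hcomp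
  let F : ℕ → ↥(insert x T) := fun n => ⟨f n, Or.inr (f n).2⟩
  have hsing : ∀ n, IsOpen ({F n} : Set ↥(insert x T)) := by
    intro n
    have hne : (f n : X) ≠ x := fun h => hx (h ▸ (f n).2)
    obtain ⟨O, N, hO, hN', hnO, hxN, hd⟩ := t2_separation hne
    rw [Set.disjoint_left] at hd
    have hfin := hN N (hN'.mem_nhds hxN)
    have ho : IsOpen (O \ ((T \ N) \ {(f n : X)})) := hO.sdiff (hfin.subset sdiff_subset).isClosed
    refine isOpen_induced_iff.2 ⟨_, ho, ?_⟩
    ext ⟨s, hs⟩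
    simp only [mem_preimage, mem_singleton_iff, F, Subtype.ext_iff]
    constructor
    · rintro ⟨h1, h2⟩
      by_contra hc
      rcases hs with rfl | hs
      · exact hd h1 hxN
      · exact h2 ⟨⟨hs, hd h1⟩, hc⟩
    · rintro rfl
      exact ⟨hnO, fun h => h.2 rfl⟩
  have hFinj : Function.Injective F := by
    intro m n h
    have : (F m).val = (F n).val := by rw [h]
    exact f.injective (Subtype.ext this)
  have hemb : IsOpenEmbedding F := by
    refine IsOpenEmbedding.of_continuous_injective_isOpenMap continuous_of_discreteTopology hFinj ?_
    intro A _
    have : F '' A = ⋃ n ∈ A, {F n} := by ext; simp [eq_comm]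
    rw [this]
    exact isOpen_biUnion fun n _ => hsing n
  have hr : range F = {(⟨x, Or.inl rfl⟩ : ↥(insert x T))}ᶜ := by
    ext ⟨s, hs⟩
    simp only [mem_range, mem_compl_iff, mem_singleton_iff, F, Subtype.ext_iff]
    constructor
    · rintro ⟨n, rfl⟩ h
      exact hx (h ▸ (f n).2)
    · intro h
      exact ⟨f.symm ⟨s, hs.resolve_left h⟩, by simp⟩
  exact ⟨(OnePoint.equivOfIsEmbeddingOfRangeEq _ F hemb.isEmbedding hr).symm⟩

lemma aleph0_le_weight {X : Type} [TopologicalSpace X] [T2Space X] [Infinite X] :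
    ℵ₀ ≤ tWeight X := by
  have hne : {c | ∃ B : Set (Set X), TopologicalSpace.IsTopologicalBasis B ∧ #B = c}.Nonempty :=
    ⟨_, _, TopologicalSpace.isTopologicalBasis_opens, rfl⟩
  obtain ⟨B, hB, hc⟩ := csInf_mem hne
  change ℵ₀ ≤ sInf _
  rw [← hc]
  by_contra hlt
  rw [not_le, Cardinal.lt_aleph0_iff_finite] at hlt
  have hinj : Function.Injective (fun x : X => {b : B | x ∈ (b : Set X)}) := by
    intro x y hxy
    by_contra hne
    obtain ⟨b, hb, hxb, hby⟩ := hB.exists_subset_of_mem_open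
      (show x ∈ ({y}ᶜ : Set X) from hne) isOpen_compl_singleton
    have : (⟨b, hb⟩ : B) ∈ {b : B | x ∈ (b : Set X)} := hxb
    have h2 : (⟨b, hb⟩ : B) ∈ {b : B | y ∈ (b : Set X)} := by
      have hxy' : {b : B | x ∈ (b : Set X)} = {b : B | y ∈ (b : Set X)} := hxy
      rw [← hxy']
      exact this
    exact hby h2 rfl
  have := Finite.of_injective _ hinj
  exact not_finite X

section
variable {X Y ι Z : Type} [TopologicalSpace X] [TopologicalSpace Y] [TopologicalSpace ι]
    [TopologicalSpace Z] {φ : ι → Set X} [CompactSpace X] [T2Space X]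
    [CompactSpace Y] [T2Space Y]
    [DiscreteTopology ι] [CompactSpace Z] [T2Space Z]

lemma ZData.lower {k : ℕ} (hk : 1 ≤ k) (d : ZData X Y ι Z φ) [FrechetUrysohnSpace X] [Nonempty Y]
    (hι : tWeight X < #ι) (hφ : ZPhiOK φ) {α : Ordinal.{0}}
    (hY : ∀ β < α, ¬ KIndLE (bComplex k) Y β)
    (F : Fin (k + 1) → Set X) (hF : ∀ i, IsClosed (F i)) (hF0 : (⋂ i, F i) = ∅)
    (hobs : ∀ U : Fin (k + 1) → Set X, KNbhd (bComplex k) F U → RLT k α (⋃ i, U i)ᶜ →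
      KObs (bComplex k) U ≠ ∅) : ¬ KIndLE (bComplex k) Z α := by
  intro hZ
  have hZ' : RLE k α (Set.univ : Set Z) := by
    have := (kindle_iff_rle (k := k) (α := α) (id : Z → Z) IsClosedEmbedding.id).1 hZ
    rwa [range_id] at this
  obtain ⟨U, hUo, hFU, hU0, hUd⟩ := rle_iff.1 hZ' (fun i => d.h '' F i)
    (fun i => d.hemb.isClosedMap _ (hF i)) (fun i => subset_univ _)
    (by rw [← d.hemb.injective.injOn.image_iInter_eq, hF0, image_empty])
  rw [univ_inter] at hU0
  rw [Set.eq_empty_iff_forall_notMem] at hU0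
  set W : Fin (k + 1) → Set X := fun i => d.h ⁻¹' U i with hWdef
  have hWo : ∀ i, IsOpen (W i) := fun i => (hUo i).preimage d.hh
  have hW0 : (⋂ i, W i) = ∅ := by
    rw [Set.eq_empty_iff_forall_notMem]
    intro x hx
    exact hU0 (d.h x) (by simpa [W] using hx)
  have hWn : KNbhd (bComplex k) F W :=
    ⟨hWo, (isKTuple_iff _).2 hW0, fun i => image_subset_iff.1 (hFU i)⟩
  have hWd : RLT k α (⋃ i, W i)ᶜ := by
    refine (rlt_image_iff d.h d.hemb (isOpen_iUnion hWo).isClosed_compl).1 (rlt_mono ?_ hUd)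
    rintro _ ⟨x, hx, rfl⟩
    exact ⟨trivial, by simpa [W] using hx⟩
  obtain ⟨x, hx⟩ := Set.nonempty_iff_ne_empty.2 (hobs W hWn hWd)
  have hxW : ∀ i, x ∉ W i := fun i hi =>
    hx ⟨W, ⟨hWo, (isKTuple_iff _).2 hW0, fun i => subset_rfl⟩, mem_iUnion.2 ⟨i, hi⟩⟩
  have hcl : ∀ j, x ∈ closure {y | ∀ i, i ≠ j → y ∈ W i} := by
    intro j
    by_contra hc
    refine hx ⟨fun i => if i = j then W i ∪ (closure {y | ∀ i, i ≠ j → y ∈ W i})ᶜ else W i,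
      ⟨?_, (isKTuple_iff _).2 ?_, ?_⟩, mem_iUnion.2 ⟨j, ?_⟩⟩
    · intro i
      dsimp only
      split_ifs
      · exact (hWo i).union isClosed_closure.isOpen_compl
      · exact hWo i
    · rw [Set.eq_empty_iff_forall_notMem] at hW0 ⊢
      intro y hy
      rw [mem_iInter] at hy
      have h1 : ∀ i, i ≠ j → y ∈ W i := fun i hi => by
        have := hy i
        rwa [if_neg hi] at this
      have h2 := hy j
      rw [if_pos rfl] at h2
      rcases h2 with h2 | h2
      · refine hW0 y (mem_iInter.2 fun i => ?_)
        by_cases hij : i = j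
        · rwa [hij]
        · exact h1 i hij
      · exact h2 (subset_closure h1)
    · intro i
      dsimp only
      split_ifs
      · exact subset_union_left
      · exact subset_rfl
    · rw [if_pos rfl]
      exact Or.inr hc
  have hseq := fun j => mem_closure_iff_seq_limit.1 (hcl j)
  choose u hu hut using hseq
  set T : Set X := ⋃ j, range (u j) with hTdef
  have hTc : T.Countable := countable_iUnion fun j => countable_range _
  have hne : ∀ j : Fin (k + 1), ∃ i, i ≠ j := by
    intro j
    by_cases hj : j = 0
    · exact ⟨Fin.last k, hj ▸ exists_ne_fin hk⟩
    · exact ⟨0, fun h => hj h.symm⟩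
  have hxT : x ∉ T := by
    intro h
    obtain ⟨j, n, hn⟩ := mem_iUnion.1 h
    obtain ⟨i, hi⟩ := hne j
    exact hxW i (hn ▸ hu j n i hi)
  have hTi : T.Infinite := by
    intro hfin
    have : x ∈ closure T := mem_closure_of_tendsto (hut 0)
      (Filter.Eventually.of_forall fun n => mem_iUnion.2 ⟨0, n, rfl⟩)
    rw [hfin.isClosed.closure_eq] at this
    exact hxT this
  have hTN : ∀ N ∈ 𝓝 x, (T \ N).Finite := by
    intro N hN
    rw [hTdef, iUnion_sdiff]
    refine finite_iUnion fun j => ?_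
    have hev := hut j hN
    rw [← Nat.cofinite_eq_atTop, Filter.mem_map, Filter.mem_cofinite] at hev
    refine (hev.image (u j)).subset ?_
    rintro _ ⟨⟨n, rfl⟩, hn⟩
    exact ⟨n, hn, rfl⟩
  have hS := sfam_of_seq hTc hTi hxT hTN
  have : Infinite X := Set.infinite_univ_iff.1 (hTi.mono (subset_univ _))
  have hunc : ¬ (φ ⁻¹' {insert x T}).Countable := by
    rw [← Cardinal.le_aleph0_iff_set_countable, hφ.2 _ hS, not_le]
    exact aleph0_le_weight.trans_lt hι
  set Bad : Set ι := ⋃ i, ⋃ s ∈ T ∩ W i,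
    {a : ι | ∃ z ∈ (U i)ᶜ ∩ d.q ⁻¹' {s}, d.p z = (a : OnePoint ι)} with hBad
  have hBadc : Bad.Countable := by
    refine countable_iUnion fun i => (hTc.mono inter_subset_left).biUnion fun s hs => ?_
    refine (fin_of_closed d.hp ((hUo i).isClosed_compl.inter
      (isClosed_singleton.preimage d.hq)) ?_).countable
    rintro z ⟨hz1, hz2⟩ hz
    refine hz1 ?_
    rw [← d.hinf z hz, mem_singleton_iff.1 hz2]
    exact hs.2
  obtain ⟨a, haA, haB⟩ : ∃ a, φ a = insert x T ∧ a ∉ Bad := by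
    by_contra hc
    push Not at hc
    exact hunc (hBadc.mono fun a ha => hc a ha)
  have hxa : x ∈ φ a := by rw [haA]; exact Or.inl rfl
  have hgU : ∀ i, ∀ s (hs : s ∈ φ a), s ∈ T → s ∈ W i → ∀ y, d.g a (⟨s, hs⟩, y) ∈ U i := by
    intro i s hs hsT hsW y
    by_contra hc
    refine haB (mem_iUnion.2 ⟨i, mem_iUnion₂.2 ⟨s, ⟨hsT, hsW⟩, d.g a (⟨s, hs⟩, y), ⟨hc, ?_⟩,
      d.pg a _⟩⟩)
    rw [mem_preimage, d.qg, mem_singleton_iff]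
  have hout : ∀ j y, d.g a (⟨x, hxa⟩, y) ∉ U j := by
    intro j y hy
    have hop : IsOpen ((fun s : φ a => d.g a (s, y)) ⁻¹' U j) :=
      (hUo j).preimage ((d.hg a).comp (by fun_prop))
    obtain ⟨O, hO, hOeq⟩ := isOpen_induced_iff.1 hop
    have hxO : x ∈ O := by
      have : (⟨x, hxa⟩ : φ a) ∈ Subtype.val ⁻¹' O := by rw [hOeq]; exact hy
      exact this
    obtain ⟨n, hn⟩ := ((hut j).eventually (hO.mem_nhds hxO)).exists
    have hnT : u j n ∈ T := mem_iUnion.2 ⟨j, n, rfl⟩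
    have hna : u j n ∈ φ a := by rw [haA]; exact Or.inr hnT
    refine hU0 (d.g a (⟨u j n, hna⟩, y)) (mem_iInter.2 fun i => ?_)
    by_cases hij : i = j
    · subst hij
      have : (⟨u i n, hna⟩ : φ a) ∈ (fun s : φ a => d.g a (s, y)) ⁻¹' U i := by
        rw [← hOeq]; exact hn
      exact this
    · exact hgU i _ hna hnT (hu j n i hij) y
  have hce : IsClosedEmbedding (fun y : Y => d.g a (⟨x, hxa⟩, y)) := by
    refine Continuous.isClosedEmbedding ((d.hg a).comp (by fun_prop)) ?_
    intro y y' h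
    have := d.ginj a h
    exact congrArg Prod.snd this
  have hsub : range (fun y : Y => d.g a (⟨x, hxa⟩, y)) ⊆ Set.univ \ ⋃ i, U i := by
    rintro _ ⟨y, rfl⟩
    refine ⟨trivial, ?_⟩
    rw [mem_iUnion, not_exists]
    exact fun j => hout j y
  rcases rlt_mono hsub hUd with h | ⟨β, hβ, h⟩
  · exact (range_nonempty (fun y : Y => d.g a (⟨x, hxa⟩, y))).ne_empty h
  · exact hY β hβ ((kindle_iff_rle _ hce).2 h)

end

section
variable {X Y ι : Type} [TopologicalSpace X] [TopologicalSpace Y] [TopologicalSpace ι]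

lemma zrel_exact {a b : OnePoint ι × X × Y} (h : Quot.mk (ZRel ι X Y) a = Quot.mk (ZRel ι X Y) b) :
    a = b ∨ ZRel ι X Y a b := by
  let f : ZQuot ι X Y → Prop := Quot.lift (fun q => a = q ∨ ZRel ι X Y a q) (by
    rintro b c hbc
    simp only [eq_iff_iff]
    constructor
    · rintro (rfl | h)
      · exact Or.inr hbc
      · exact Or.inr ⟨h.1, hbc.2.1, h.2.2.trans hbc.2.2⟩
    · rintro (rfl | h)
      · exact Or.inr ⟨hbc.2.1, hbc.1, hbc.2.2.symm⟩
      · exact Or.inr ⟨h.1, hbc.1, h.2.2.trans hbc.2.2.symm⟩)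
  have h1 : f (Quot.mk _ a) := Or.inl rfl
  rw [h] at h1
  exact h1

/-- The projection of `N` to `A_𝔪`. -/
def quotP : ZQuot ι X Y → OnePoint ι :=
  Quot.lift (fun p => p.1) (fun _ _ h => h.1.trans h.2.1.symm)

lemma continuous_quotP : Continuous (quotP : ZQuot ι X Y → OnePoint ι) :=
  continuous_quot_lift _ continuous_fst

lemma continuous_quotQ : Continuous (ZQuotProjX : ZQuot ι X Y → X) :=
  continuous_quot_lift _ (continuous_fst.comp continuous_snd)

lemma t2_zquot [T2Space X] [T2Space Y] [DiscreteTopology ι] : T2Space (ZQuot ι X Y) := by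
  refine ⟨fun z w hzw => ?_⟩
  by_cases hp : quotP z = quotP w
  swap
  · obtain ⟨O, O', h1, h2, h3, h4, h5⟩ := t2_separation hp
    exact ⟨_, _, h1.preimage continuous_quotP, h2.preimage continuous_quotP, h3, h4,
      h5.preimage _⟩
  by_cases hq : ZQuotProjX z = ZQuotProjX w
  swap
  · obtain ⟨O, O', h1, h2, h3, h4, h5⟩ := t2_separation hq
    exact ⟨_, _, h1.preimage continuous_quotQ, h2.preimage continuous_quotQ, h3, h4,
      h5.preimage _⟩
  induction z using Quot.ind with | mk z =>
  induction w using Quot.ind with | mk w =>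
  obtain ⟨a, x, y⟩ := z
  obtain ⟨b, x', y'⟩ := w
  change a = b at hp
  change x = x' at hq
  subst hp hq
  rcases a with _ | a
  · exact (hzw (Quot.sound ⟨rfl, rfl, rfl⟩)).elim
  have hy : y ≠ y' := by rintro rfl; exact hzw rfl
  obtain ⟨O, O', h1, h2, h3, h4, h5⟩ := t2_separation hy
  have hopen : ∀ O : Set Y, IsOpen O → IsOpen (Quot.mk (ZRel ι X Y) ''
      (({(a : OnePoint ι)} : Set (OnePoint ι)) ×ˢ ((Set.univ : Set X) ×ˢ O))) := by
    intro O hO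
    rw [← isQuotientMap_quot_mk.isOpen_preimage]
    have : Quot.mk (ZRel ι X Y) ⁻¹' (Quot.mk (ZRel ι X Y) ''
      (({(a : OnePoint ι)} : Set (OnePoint ι)) ×ˢ ((Set.univ : Set X) ×ˢ O))) =
      (({(a : OnePoint ι)} : Set (OnePoint ι)) ×ˢ ((Set.univ : Set X) ×ˢ O)) := by
      refine Subset.antisymm ?_ (subset_preimage_image _ _)
      rintro r ⟨s, hs, hsr⟩
      rcases zrel_exact hsr with rfl | hrel
      · exact hs
      · exfalso
        have h1 : s.1 = (a : OnePoint ι) := hs.1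
        exact OnePoint.coe_ne_infty a (h1.symm.trans hrel.1)
    rw [this]
    have hs : IsOpen ({(a : OnePoint ι)} : Set (OnePoint ι)) := by
      have := (OnePoint.isOpenEmbedding_coe (X := ι)).isOpenMap {a} (isOpen_discrete _)
      simpa using this
    exact hs.prod (isOpen_univ.prod hO)
  refine ⟨_, _, hopen O h1, hopen O' h2, ⟨((a : OnePoint ι), x, y), ⟨rfl, trivial, h3⟩, rfl⟩,
    ⟨((a : OnePoint ι), x, y'), ⟨rfl, trivial, h4⟩, rfl⟩, ?_⟩
  rw [Set.disjoint_left]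
  rintro _ ⟨r, hr, rfl⟩ ⟨s, hs, hsr⟩
  rcases zrel_exact hsr with rfl | hrel
  · exact (Set.disjoint_left.1 h5) hr.2.2 hs.2.2
  · have h1 : s.1 = (a : OnePoint ι) := hs.1
    exact OnePoint.coe_ne_infty a (h1.symm.trans hrel.1)

lemma mem_zset {φ : ι → Set X} {p : OnePoint ι × X × Y} :
    Quot.mk (ZRel ι X Y) p ∈ ZSet ι X Y φ ↔
      (p.1 = OnePoint.infty ∨ ∃ i : ι, p.1 = (i : OnePoint ι) ∧ p.2.1 ∈ φ i) := by
  constructor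
  · rintro ⟨r, hr, h⟩
    rcases zrel_exact hr with rfl | hrel
    · exact h
    · exact Or.inl hrel.2.1
  · exact fun h => ⟨p, rfl, h⟩

lemma closed_zset [DiscreteTopology ι] {φ : ι → Set X} (hφ : ∀ i, IsClosed (φ i)) :
    IsClosed (ZSet ι X Y φ) := by
  rw [← isQuotientMap_quot_mk.isClosed_preimage, ← isOpen_compl_iff]
  have : (Quot.mk (ZRel ι X Y) ⁻¹' ZSet ι X Y φ)ᶜ =
      ⋃ i : ι, ({(i : OnePoint ι)} : Set (OnePoint ι)) ×ˢ ((φ i)ᶜ ×ˢ (Set.univ : Set Y)) := by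
    ext ⟨a, x, y⟩
    rw [mem_compl_iff, mem_preimage, mem_zset, mem_iUnion]
    rcases a with _ | a
    · constructor
      · exact fun h => (h (Or.inl rfl)).elim
      · rintro ⟨i, h, -⟩
        exact (OnePoint.infty_ne_coe i h).elim
    · constructor
      · intro h
        exact ⟨a, rfl, fun hx => h (Or.inr ⟨a, rfl, hx⟩), trivial⟩
      · rintro ⟨i, h, hx, -⟩ (h' | ⟨j, h', hx'⟩)
        · exact OnePoint.coe_ne_infty a h'
        · have e1 : a = i := OnePoint.coe_injective h
          have e2 : a = j := OnePoint.coe_injective h'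
          subst e1 e2
          exact hx hx'
  rw [this]
  refine isOpen_iUnion fun i => ?_
  have hs : IsOpen ({(i : OnePoint ι)} : Set (OnePoint ι)) := by
    have := (OnePoint.isOpenEmbedding_coe (X := ι)).isOpenMap {i} (isOpen_discrete _)
    simpa using this
  exact hs.prod ((hφ i).isOpen_compl.prod isOpen_univ)

/-- The concrete space carries the abstract data. -/
def zdata (φ : ι → Set X) (y₀ : Y) : ZData X Y ι (ZSpace ι X Y φ) φ where
  p := fun z => quotP z.1
  q := fun z => ZQuotProjX z.1
  h := fun x => ⟨Quot.mk _ (OnePoint.infty, x, y₀), mem_zset.2 (Or.inl rfl)⟩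
  g := fun a t => ⟨Quot.mk _ ((a : OnePoint ι), (t.1 : X), t.2), mem_zset.2 (Or.inr ⟨a, rfl, t.1.2⟩)⟩
  hp := continuous_quotP.comp continuous_subtype_val
  hq := continuous_quotQ.comp continuous_subtype_val
  hh := Continuous.subtype_mk (continuous_quot_mk.comp (by fun_prop)) _
  hg := fun a => Continuous.subtype_mk (continuous_quot_mk.comp (by fun_prop)) _
  qh := fun _ => rfl
  ph := fun _ => rfl
  hinf := by
    rintro ⟨z, hz⟩ h
    induction z using Quot.ind with | mk z =>
    exact Subtype.ext (Quot.sound ⟨rfl, h, rfl⟩)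
  ginj := by
    rintro a ⟨s, y⟩ ⟨s', y'⟩ h
    rcases zrel_exact (congrArg Subtype.val h) with h | h
    · simp only [Prod.mk.injEq, true_and] at h
      exact Prod.ext (Subtype.ext h.1) h.2
    · exact (OnePoint.coe_ne_infty a h.1).elim
  pg := fun _ _ => rfl
  qg := fun _ _ => rfl
  gsurj := by
    rintro a ⟨z, hz⟩ h
    induction z using Quot.ind with | mk z =>
    obtain ⟨b, x, y⟩ := z
    change b = (a : OnePoint ι) at h
    subst h
    rcases mem_zset.1 hz with h | ⟨i, h, hx⟩
    · exact (OnePoint.coe_ne_infty a h).elim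
    · have e : a = i := OnePoint.coe_injective h
      subst e
      exact ⟨(⟨x, hx⟩, y), rfl⟩

end

end S17

-- STATEMENT 17
theorem statement17 (k : ℕ) (hk : 1 ≤ k)
    (X Y : Type) [TopologicalSpace X] [TopologicalSpace Y]
    [CompactSpace X] [CompactSpace Y] [T2Space X] [T2Space Y] [Nonempty X] [Nonempty Y]
    [FrechetUrysohnSpace X]
    (ι : Type) [TopologicalSpace ι] [DiscreteTopology ι]
    (hι : ZCardOK X Y ι) (φ : ι → Set X) (hφ : ZPhiOK φ)
    (hstr : KStr (bComplex k) X = 1)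
    (hind : KInd (bComplex k) X = KInd (bComplex k) Y) :
    KInd (bComplex k) (ZSpace ι X Y φ) = KInd (bComplex k) X + 1 := by
  have hs : KStrongly (bComplex k) X := by
    unfold KStr at hstr
    by_contra h
    rw [if_neg h] at hstr
    exact zero_ne_one hstr
  obtain ⟨⟨α, -, hα⟩, F, hF, hF0, hobs⟩ := hs
  have hX := S17.kind_eq hα
  have hY := S17.kind_eq (hind ▸ hα)
  have : T2Space (ZQuot ι X Y) := S17.t2_zquot
  have hcl : IsClosed (ZSet ι X Y φ) :=
    S17.closed_zset fun i => (S17.sfam_compact (hφ.1 i)).isClosed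
  have : CompactSpace (ZSpace ι X Y φ) := isCompact_iff_compactSpace.1 hcl.isCompact
  obtain ⟨y₀⟩ := ‹Nonempty Y›
  obtain ⟨x₀⟩ := ‹Nonempty X›
  let d := S17.zdata (ι := ι) φ y₀
  have : Nonempty (ZSpace ι X Y φ) := ⟨d.h x₀⟩
  have : Nonempty Y := ⟨y₀⟩
  have hup := d.upper hk hφ.1 hX.1 hY.1
  have hlow := d.lower hk hι.2.1 hφ hY.2 F hF ((S17.isKTuple_iff _).1 hF0) (by
    intro U hU hd
    refine hobs U hU ?_
    rw [hα]
    exact S17.kind_lt_of_rlt (isOpen_iUnion hU.1).isClosed_compl hd)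
  have hres : KInd (bComplex k) (ZSpace ι X Y φ) = Dim.ofOrdinal (α + 1) := by
    refine S17.kind_eq_of hup ?_
    intro β hβ h
    have hβα : β ≤ α := Order.lt_add_one_iff.1 hβ
    have e := IsClosedEmbedding.id (X := ZSpace ι X Y φ)
    exact hlow ((S17.kindle_iff_rle _ e).2
      (S17.rle_mono_ord hβα ((S17.kindle_iff_rle _ e).1 h)))
  rw [hres, hα]
  rfl

end
end
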